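/- Let A be a unital complex C*-algebra, Y a real normed space, T : S_A → S_Y a surjective isometry, and E ⊂ S_A a maximal face of the unit sphere. Then the restriction T|_E is affine. -/

import Mathlib

variable {X : Type*} [NormedAddCommGroup X] [NormedSpace ℝ X]

/-- A *face* of the closed unit ball `B_X`: a nonempty convex subset `F ⊆ B_X` such that
whenever a point of an open segment contained in `B_X` lies in `F`, the whole segment
lies in `F`. -/
def IsFace (F : Set X) : Prop :=
  F.Nonempty ∧ Convex ℝ F ∧ IsExtreme ℝ (Metric.closedBall (0 : X) 1) F

/-- A *maximal face* of the unit sphere `S_X`: a face of `B_X` contained in `S_X` that is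
maximal among proper faces of `B_X`. -/
def IsMaximalFace (F : Set X) : Prop :=
  IsFace F ∧ F ⊆ Metric.sphere (0 : X) 1 ∧
    ∀ G : Set X, IsFace G → G ≠ Metric.closedBall (0 : X) 1 → F ⊆ G → F = G

open Metric Set

section NormedSpacePart

variable {V Y : Type*} [NormedAddCommGroup V] [NormedSpace ℝ V]
  [NormedAddCommGroup Y] [NormedSpace ℝ Y]

/-- A convex set outside the open unit ball is separated from it by a functional of norm at
most one. -/
theorem exists_dual_one_le_of_convex {C : Set V} (hC : Convex ℝ C) (h1 : ∀ x ∈ C, 1 ≤ ‖x‖) :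
    ∃ f : V →L[ℝ] ℝ, (∀ x, |f x| ≤ ‖x‖) ∧ ∀ x ∈ C, 1 ≤ f x := by
  rcases C.eq_empty_or_nonempty with rfl | ⟨c, hc⟩
  · exact ⟨0, by simp, by simp⟩
  obtain ⟨f, u, hf, hu⟩ := geometric_hahn_banach_open (convex_ball (0 : V) 1) isOpen_ball hC
    (Set.disjoint_left.2 fun x hx hx' => by
      have := h1 x hx'; rw [mem_ball_zero_iff] at hx; linarith)
  have hu0 : 0 < u := by simpa using hf 0 (by simp)
  have key : ∀ x, f x ≤ u * ‖x‖ := by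
    intro x
    refine le_of_forall_pos_lt_add fun ε hε => ?_
    obtain ⟨δ, hδ, hδ'⟩ : ∃ δ > 0, u * δ < ε := ⟨ε / (2 * u), by positivity, by
      rw [mul_div_assoc']; rw [div_lt_iff₀ (by positivity)]; nlinarith⟩
    have hp : 0 < ‖x‖ + δ := by positivity
    have := hf ((‖x‖ + δ)⁻¹ • x) (by
      rw [mem_ball_zero_iff, norm_smul, norm_inv, Real.norm_of_nonneg hp.le,
        inv_mul_lt_iff₀ hp]; linarith)
    rw [map_smul, smul_eq_mul, inv_mul_lt_iff₀ hp] at this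
    nlinarith
  refine ⟨u⁻¹ • f, fun x => abs_le.2 ⟨?_, ?_⟩, fun x hx => ?_⟩
  · have := key (-x)
    rw [map_neg, norm_neg] at this
    simp only [smul_apply, smul_eq_mul]
    rw [neg_le, ← mul_neg, inv_mul_le_iff₀ hu0]; exact this
  · simp only [smul_apply, smul_eq_mul]
    rw [inv_mul_le_iff₀ hu0]; exact key x
  · simp only [smul_apply, smul_eq_mul]
    rw [le_inv_mul_iff₀ hu0]; simpa using hu x hx

/-- A convex subset of the unit sphere is supported by a single functional. -/
theorem exists_dual_eq_one_of_convex {C : Set V} (hC : Convex ℝ C) (h1 : ∀ x ∈ C, ‖x‖ = 1) :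
    ∃ f : V →L[ℝ] ℝ, (∀ x, |f x| ≤ ‖x‖) ∧ ∀ x ∈ C, f x = 1 := by
  obtain ⟨f, hf, hf'⟩ := exists_dual_one_le_of_convex hC fun x hx => (h1 x hx).ge
  exact ⟨f, hf, fun x hx => le_antisymm ((le_abs_self _).trans ((hf x).trans (h1 x hx).le))
    (hf' x hx)⟩

theorem isFace_of_dual {f : V →L[ℝ] ℝ} (hf : ∀ x, |f x| ≤ ‖x‖) {x₀ : V} (hx₀ : ‖x₀‖ ≤ 1)
    (h₀ : f x₀ = 1) : IsFace {x : V | ‖x‖ ≤ 1 ∧ f x = 1} := by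
  refine ⟨⟨x₀, hx₀, h₀⟩, ?_, ?_⟩
  · rintro x ⟨hx, hx'⟩ y ⟨hy, hy'⟩ a b ha hb hab
    refine ⟨?_, by simp [hx', hy', hab]⟩
    have := convex_closedBall (0 : V) 1 (mem_closedBall_zero_iff.2 hx)
      (mem_closedBall_zero_iff.2 hy) ha hb hab
    exact mem_closedBall_zero_iff.1 this
  · refine ⟨fun x hx => mem_closedBall_zero_iff.2 hx.1, ?_⟩
    rintro x hx y hy z ⟨hz, hz'⟩ ⟨a, b, ha, hb, hab, rfl⟩
    rw [mem_closedBall_zero_iff] at hx hy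
    refine ⟨hx, ?_⟩
    simp only [map_add, map_smul, smul_eq_mul] at hz'
    have h1 := (abs_le.1 (hf x)).2
    have h2 := (abs_le.1 (hf y)).2
    nlinarith

theorem IsMaximalFace.eq_of_dual {E : Set V} (hE : IsMaximalFace E) {f : V →L[ℝ] ℝ}
    (hf : ∀ x, |f x| ≤ ‖x‖) (h1 : ∀ x ∈ E, f x = 1) : E = {x : V | ‖x‖ ≤ 1 ∧ f x = 1} := by
  obtain ⟨x₀, hx₀⟩ := hE.1.1
  have hx1 := mem_sphere_zero_iff_norm.1 (hE.2.1 hx₀)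
  refine hE.2.2 _ (isFace_of_dual hf hx1.le (h1 _ hx₀)) ?_
    fun x hx => ⟨(mem_sphere_zero_iff_norm.1 (hE.2.1 hx)).le, h1 x hx⟩
  intro h
  have : (0 : V) ∈ {x : V | ‖x‖ ≤ 1 ∧ f x = 1} := by rw [h]; simp
  simpa using this.2

theorem IsMaximalFace.norm_eq_one {E : Set V} (hE : IsMaximalFace E) {x : V} (hx : x ∈ E) :
    ‖x‖ = 1 := mem_sphere_zero_iff_norm.1 (hE.2.1 hx)

theorem IsMaximalFace.exists_dual {E : Set V} (hE : IsMaximalFace E) :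
    ∃ f : V →L[ℝ] ℝ, (∀ x, |f x| ≤ ‖x‖) ∧ E = {x : V | ‖x‖ ≤ 1 ∧ f x = 1} := by
  obtain ⟨f, hf, h1⟩ := exists_dual_eq_one_of_convex hE.1.2.1 fun x hx => hE.norm_eq_one hx
  exact ⟨f, hf, hE.eq_of_dual hf h1⟩

/-- If two unit vectors have a sum of norm two, every convex combination has norm one. -/
theorem norm_combo_of_norm_add_eq_two {x y : V} (hx : ‖x‖ ≤ 1) (hy : ‖y‖ ≤ 1)
    (h : 2 ≤ ‖x + y‖) {a b : ℝ} (hab : a + b = 1) :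
    1 ≤ ‖a • x + b • y‖ := by
  obtain ⟨g, hg, hgx⟩ := exists_dual_vector'' ℝ (x + y)
  simp only [map_add, RCLike.ofReal_real_eq_id, id] at hgx
  have h1 : ∀ z, |g z| ≤ ‖z‖ := fun z => by
    simpa using (g.le_opNorm z).trans (mul_le_of_le_one_left (norm_nonneg _) hg)
  have hx' := (abs_le.1 (h1 x)).2
  have hy' := (abs_le.1 (h1 y)).2
  have e1 : g x = 1 := by linarith
  have e2 : g y = 1 := by linarith
  have := (abs_le.1 (h1 (a • x + b • y))).2
  simpa [e1, e2, hab] using this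

theorem IsMaximalFace.mem_of_norm_add {E : Set V} (hE : IsMaximalFace E) {y : V} (hy : ‖y‖ = 1)
    (h : ∀ x ∈ E, ‖x + y‖ = 2) : y ∈ E := by
  have hconv : Convex ℝ (convexJoin ℝ E {y}) := hE.1.2.1.convexJoin (convex_singleton y)
  obtain ⟨f, hf, h1⟩ := exists_dual_one_le_of_convex hconv (by
    intro x hx
    rw [mem_convexJoin] at hx
    obtain ⟨a, ha, b, rfl, c, d, -, -, hcd, rfl⟩ := hx
    exact norm_combo_of_norm_add_eq_two (hE.norm_eq_one ha).le hy.le (h a ha).ge hcd)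
  have hle : ∀ x, ‖x‖ = 1 → 1 ≤ f x → f x = 1 := fun x hx h' =>
    le_antisymm ((abs_le.1 (hf x)).2.trans hx.le) h'
  obtain ⟨x₀, hx₀⟩ := hE.1.1
  have hyj : y ∈ convexJoin ℝ E {y} := by
    rw [mem_convexJoin]; exact ⟨x₀, hx₀, y, rfl, right_mem_segment _ _ _⟩
  have := hE.eq_of_dual hf fun x hx => hle x (hE.norm_eq_one hx) (h1 x (by
    rw [mem_convexJoin]; exact ⟨x, hx, y, rfl, left_mem_segment _ _ _⟩))
  rw [this]
  exact ⟨hy.le, hle y hy (h1 y hyj)⟩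

end NormedSpacePart

section SphereIsometry

variable {V Y : Type*} [NormedAddCommGroup V] [NormedSpace ℝ V]
  [NormedAddCommGroup Y] [NormedSpace ℝ Y]

/-- `T` restricts to a surjective isometry between the unit spheres. -/
structure IsSphereIsometry (T : V → Y) : Prop where
  norm_sub : ∀ x y, ‖x‖ = 1 → ‖y‖ = 1 → ‖T x - T y‖ = ‖x - y‖
  norm_map : ∀ x, ‖x‖ = 1 → ‖T x‖ = 1
  surj : ∀ p, ‖p‖ = 1 → ∃ x, ‖x‖ = 1 ∧ T x = p

theorem two_le_norm_add_of_midpoint {a b y : V} (ha : ‖a‖ ≤ 1) (hb : ‖b‖ ≤ 1) (hy : ‖y‖ ≤ 1)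
    (h : 2 ≤ ‖y + (1 / 2 : ℝ) • (a + b)‖) : 2 ≤ ‖y + a‖ ∧ 2 ≤ ‖y + b‖ := by
  have e : y + (1 / 2 : ℝ) • (a + b) = (1 / 2 : ℝ) • (y + a) + (1 / 2 : ℝ) • (y + b) := by
    module
  have h1 := norm_add_le ((1 / 2 : ℝ) • (y + a)) ((1 / 2 : ℝ) • (y + b))
  rw [← e, norm_smul, norm_smul, Real.norm_of_nonneg (by norm_num)] at h1
  have h2 := norm_add_le y a
  have h3 := norm_add_le y b
  constructor <;> linarith

theorem exists_dual_eq_norm (x : V) : ∃ g : V →L[ℝ] ℝ, (∀ z, |g z| ≤ ‖z‖) ∧ g x = ‖x‖ := by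
  obtain ⟨g, hg, hgx⟩ := exists_dual_vector'' ℝ x
  exact ⟨g, fun z => by
    simpa using (g.le_opNorm z).trans (mul_le_of_le_one_left (norm_nonneg _) hg), by simpa using hgx⟩

theorem exists_dominating {C : Set V} (hC : Convex ℝ C) (h1 : ∀ x ∈ C, ‖x‖ = 1)
    {x₁ : V} (hx₁ : x₁ ∈ C) (t : Finset V) (ht : ∀ x ∈ t, x ∈ C) :
    ∃ x₀ ∈ C, ∀ y, ‖y‖ = 1 → 2 ≤ ‖y + x₀‖ → ∀ x ∈ t, 2 ≤ ‖y + x‖ := by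
  classical
  induction t using Finset.induction_on with
  | empty => exact ⟨x₁, hx₁, by simp⟩
  | insert a s _ ih =>
    obtain ⟨x₀, hx₀, h⟩ := ih fun x hx => ht x (Finset.mem_insert_of_mem hx)
    have ha := ht a (Finset.mem_insert_self _ _)
    refine ⟨(1 / 2 : ℝ) • (x₀ + a), ?_, fun y hy hy' x hx => ?_⟩
    · have := hC hx₀ ha (a := 1 / 2) (b := 1 / 2) (by norm_num) (by norm_num) (by norm_num)
      rwa [← smul_add] at this
    · have := two_le_norm_add_of_midpoint (h1 _ hx₀).le (h1 _ ha).le hy.le hy'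
      rcases Finset.mem_insert.1 hx with rfl | hx
      · exact this.2
      · exact h y hy this.1 x hx

theorem exists_dual_eq_one_of_dominated {m : V} (hm : ‖m‖ = 1) (t : Finset V)
    (ht : ∀ x ∈ t, ‖x‖ = 1)
    (h : ∀ p, ‖p‖ = 1 → 2 ≤ ‖p + m‖ → ∀ x ∈ t, 2 ≤ ‖p + x‖) :
    ∃ g : V →L[ℝ] ℝ, (∀ z, |g z| ≤ ‖z‖) ∧ ∀ x ∈ t, g x = 1 := by
  classical
  have key : ∀ u : Finset V, u ⊆ t → ∃ s : V, ‖s‖ = 1 ∧ ∀ g : V →L[ℝ] ℝ, (∀ z, |g z| ≤ ‖z‖) →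
      g s = 1 → g m = 1 ∧ ∀ x ∈ u, g x = 1 := by
    intro u
    induction u using Finset.induction_on with
    | empty => exact fun _ => ⟨m, hm, by simp +contextual⟩
    | insert a s _ ih =>
      intro hu
      obtain ⟨s, hs, hg⟩ := ih ((Finset.subset_insert _ _).trans hu)
      have hat : a ∈ t := hu (Finset.mem_insert_self _ _)
      have h2 : 2 ≤ ‖s + a‖ := by
        refine h s hs ?_ a hat
        obtain ⟨g, hg1, hg2⟩ := exists_dual_eq_norm s
        rw [hs] at hg2
        have := (abs_le.1 (hg1 (s + m))).2
        rw [map_add, hg2, (hg g hg1 hg2).1] at this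
        linarith
      refine ⟨(1 / 2 : ℝ) • (s + a), ?_, fun g hg1 hg2 => ?_⟩
      · have := norm_add_le s a
        rw [hs, ht a hat] at this
        rw [norm_smul]; norm_num; linarith
      · have e1 := (abs_le.1 (hg1 s)).2
        have e2 := (abs_le.1 (hg1 a)).2
        rw [hs] at e1
        rw [ht a hat] at e2
        simp only [map_smul, map_add, smul_eq_mul] at hg2
        have := hg g hg1 (by linarith)
        refine ⟨this.1, fun x hx => ?_⟩
        rcases Finset.mem_insert.1 hx with rfl | hx
        · linarith
        · exact this.2 x hx
  obtain ⟨s, hs, h⟩ := key t subset_rfl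
  obtain ⟨g, hg1, hg2⟩ := exists_dual_eq_norm s
  exact ⟨g, hg1, (h g hg1 (hg2.trans hs)).2⟩

namespace IsSphereIsometry

variable {T : V → Y}

/-- A convex subset `C` of the sphere has a common support functional for `T C` and `-T (-C)`. -/
theorem exists_support (hT : IsSphereIsometry T) {C : Set V} (hC : Convex ℝ C) (h1 : ∀ x ∈ C, ‖x‖ = 1) :
    ∃ f : Y →L[ℝ] ℝ, (∀ y, |f y| ≤ ‖y‖) ∧ ∀ x ∈ C, f (T x) = 1 ∧ f (T (-x)) = -1 := by
  classical
  set P : Set Y := T '' C ∪ (fun x => -T (-x)) '' C with hP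
  have hP1 : ∀ p ∈ P, ‖p‖ = 1 := by
    rintro p (⟨x, hx, rfl⟩ | ⟨x, hx, rfl⟩)
    · exact hT.norm_map x (h1 x hx)
    · simpa using hT.norm_map (-x) (by simpa using h1 x hx)
  have hfin : ∀ t : Finset Y, (t : Set Y) ⊆ P →
      ∃ g : Y →L[ℝ] ℝ, (∀ z, |g z| ≤ ‖z‖) ∧ ∀ x ∈ t, g x = 1 := by
    intro t ht
    rcases t.eq_empty_or_nonempty with rfl | ⟨p₁, hp₁⟩
    · exact ⟨0, by simp, by simp⟩
    have hpre : ∀ p : t, ∃ x ∈ C, T x = p ∨ -T (-x) = p := by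
      rintro ⟨p, hp⟩
      rcases ht hp with ⟨x, hx, h⟩ | ⟨x, hx, h⟩
      · exact ⟨x, hx, Or.inl h⟩
      · exact ⟨x, hx, Or.inr h⟩
    choose φ hφ hφ' using hpre
    obtain ⟨x₀, hx₀, hdom⟩ := exists_dominating hC h1 (hφ ⟨p₁, hp₁⟩) (Finset.univ.image φ) (by
      simp only [Finset.mem_image, Finset.mem_univ, true_and, forall_exists_index,
        forall_apply_eq_imp_iff]
      exact hφ)
    have n0 := h1 _ hx₀
    have n0' : ‖-x₀‖ = 1 := by simpa using n0
    have hm : ‖(1 / 2 : ℝ) • (T x₀ + -T (-x₀))‖ = 1 := by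
      rw [← sub_eq_add_neg, norm_smul, hT.norm_sub _ _ n0 n0', sub_neg_eq_add, ← two_smul ℝ x₀,
        norm_smul, n0]
      norm_num
    refine exists_dual_eq_one_of_dominated hm t (fun x hx => hP1 _ (ht hx)) fun p hp h2 q hq => ?_
    obtain ⟨ha, hb⟩ := two_le_norm_add_of_midpoint (hT.norm_map _ n0).le
      (by simpa using (hT.norm_map _ n0').le) hp.le h2
    have nq := h1 _ (hφ ⟨q, hq⟩)
    have nq' : ‖-φ ⟨q, hq⟩‖ = 1 := by simpa using nq
    have hmem : φ ⟨q, hq⟩ ∈ Finset.univ.image φ := Finset.mem_image_of_mem _ (Finset.mem_univ _)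
    rcases hφ' ⟨q, hq⟩ with h | h
    · obtain ⟨u, hu, hu'⟩ := hT.surj (-p) (by simpa using hp)
      obtain rfl : p = -T u := by rw [hu', neg_neg]
      have e : ∀ z, ‖z‖ = 1 → ‖-T u + T z‖ = ‖-u + z‖ := fun z hz => by
        rw [neg_add_eq_sub, hT.norm_sub _ _ hz hu, neg_add_eq_sub]
      rw [← show T (φ ⟨q, hq⟩) = q from h, e _ nq]
      rw [e _ n0] at ha
      exact hdom _ (by simpa using hu) ha _ hmem
    · obtain ⟨u, hu, rfl⟩ := hT.surj p hp
      have e : ∀ z, ‖z‖ = 1 → ‖T u + -T (-z)‖ = ‖u + z‖ := fun z hz => by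
        rw [← sub_eq_add_neg, hT.norm_sub _ _ hu (by simpa using hz), sub_neg_eq_add]
      rw [← show -T (-φ ⟨q, hq⟩) = q from h, e _ nq]
      rw [e _ n0] at hb
      exact hdom _ hu hb _ hmem
  obtain ⟨f, hf, hf1⟩ := exists_dual_one_le_of_convex (convex_convexHull ℝ P) (by
    intro x hx
    rw [convexHull_eq_union_convexHull_finite_subsets] at hx
    simp only [mem_iUnion] at hx
    obtain ⟨t, ht, hx⟩ := hx
    obtain ⟨g, hg, hg1⟩ := hfin t ht
    have : x ∈ {z | 1 ≤ g z} := convexHull_min (fun z hz => (hg1 z hz).ge)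
      (convex_halfSpace_ge g.toLinearMap.isLinear 1) hx
    exact le_trans this ((abs_le.1 (hg x)).2))
  refine ⟨f, hf, fun x hx => ⟨?_, ?_⟩⟩
  · have m1 : T x ∈ P := Or.inl ⟨x, hx, rfl⟩
    exact le_antisymm ((abs_le.1 (hf _)).2.trans (hP1 _ m1).le) (hf1 _ (subset_convexHull ℝ _ m1))
  · have m1 : -T (-x) ∈ P := Or.inr ⟨x, hx, rfl⟩
    have := le_antisymm ((abs_le.1 (hf _)).2.trans (hP1 _ m1).le)
      (hf1 _ (subset_convexHull ℝ _ m1))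
    rw [map_neg] at this
    linarith

/-- The image of a maximal face under a sphere isometry is convex. -/
theorem exists_mem_map_eq_combo (hT : IsSphereIsometry T) {E : Set V}
    (hE : IsMaximalFace E) {y z : V} (hy : y ∈ E) (hz : z ∈ E) {μ : ℝ} (h0 : 0 ≤ μ) (h1 : μ ≤ 1) :
    ∃ w ∈ E, T w = (1 - μ) • T y + μ • T z := by
  obtain ⟨f, hf, hf1⟩ := hT.exists_support hE.1.2.1 fun x hx => hE.norm_eq_one hx
  have hfp : f ((1 - μ) • T y + μ • T z) = 1 := by
    simp [(hf1 y hy).1, (hf1 z hz).1]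
  have hn : ‖(1 - μ) • T y + μ • T z‖ = 1 := by
    refine le_antisymm ?_ (by simpa [hfp] using hf ((1 - μ) • T y + μ • T z))
    refine (norm_add_le _ _).trans ?_
    rw [norm_smul, norm_smul, hT.norm_map _ (hE.norm_eq_one hy),
      hT.norm_map _ (hE.norm_eq_one hz), Real.norm_of_nonneg h0,
      Real.norm_of_nonneg (by linarith)]
    linarith
  obtain ⟨w, hw, hTw⟩ := hT.surj _ hn
  refine ⟨w, hE.mem_of_norm_add hw fun x hx => ?_, hTw⟩
  have nx := hE.norm_eq_one hx
  refine le_antisymm ((norm_add_le _ _).trans (by rw [nx, hw]; norm_num)) ?_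
  have e : ‖x + w‖ = ‖T w - T (-x)‖ := by
    rw [hT.norm_sub _ _ hw (by simpa using nx), sub_neg_eq_add, add_comm]
  rw [e]
  have := (abs_le.1 (hf (T w - T (-x)))).2
  rw [map_sub, (hf1 x hx).2, hTw, hfp] at this
  rw [hTw]
  linarith

end IsSphereIsometry

end SphereIsometry

section CStarBasics

variable {A : Type*} [CStarAlgebra A] [PartialOrder A] [StarOrderedRing A]

theorem norm_le_one_iff_star_mul_self_le (x : A) : ‖x‖ ≤ 1 ↔ star x * x ≤ 1 := by
  rw [← CStarAlgebra.norm_le_one_iff_of_nonneg (star x * x) (star_mul_self_nonneg x),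
    CStarRing.norm_star_mul_self]
  constructor <;> intro h <;> nlinarith [norm_nonneg x]

theorem star_mul_self_le_sq_smul_one {x : A} {r : ℝ} (h : ‖x‖ ≤ r) :
    star x * x ≤ (r ^ 2) • (1 : A) := by
  refine (CStarAlgebra.star_mul_le_algebraMap_norm_sq (a := x)).trans ?_
  rw [Algebra.algebraMap_eq_smul_one]
  exact smul_le_smul_of_nonneg_right (by gcongr) zero_le_one

theorem mul_star_self_le_sq_smul_one {x : A} {r : ℝ} (h : ‖x‖ ≤ r) :
    x * star x ≤ (r ^ 2) • (1 : A) := by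
  simpa using star_mul_self_le_sq_smul_one (x := star x) (by simpa using h)

theorem star_mul_self_le_one {x : A} (h : ‖x‖ ≤ 1) : star x * x ≤ 1 :=
  (norm_le_one_iff_star_mul_self_le x).1 h

theorem mul_star_self_le_one {x : A} (h : ‖x‖ ≤ 1) : x * star x ≤ 1 := by
  simpa using star_mul_self_le_one (x := star x) (by simpa using h)

theorem norm_sq_le_of_star_mul_self_le {x y : A} (h : star x * x ≤ y) : ‖x‖ ^ 2 ≤ ‖y‖ := by
  rw [sq, ← CStarRing.norm_star_mul_self]
  exact CStarAlgebra.norm_le_norm_of_nonneg_of_le (star_mul_self_nonneg x) h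

theorem norm_sq_le_of_mul_star_self_le {x y : A} (h : x * star x ≤ y) : ‖x‖ ^ 2 ≤ ‖y‖ := by
  have := norm_sq_le_of_star_mul_self_le (x := star x) (y := y) (by simpa using h)
  simpa using this

/-- A row contraction applied to a column contraction is a contraction. -/
theorem norm_row_mul_column_le {r₁ r₂ y₁ y₂ : A} (hr : r₁ * star r₁ + r₂ * star r₂ ≤ 1)
    (hy : star y₁ * y₁ + star y₂ * y₂ ≤ 1) : ‖r₁ * y₁ + r₂ * y₂‖ ≤ 1 := by
  set X := r₁ * y₁ + r₂ * y₂ with hX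
  rw [norm_le_one_iff_star_mul_self_le]
  have h1 : 0 ≤ star (y₁ - star r₁ * X) * (y₁ - star r₁ * X) +
      star (y₂ - star r₂ * X) * (y₂ - star r₂ * X) :=
    add_nonneg (star_mul_self_nonneg _) (star_mul_self_nonneg _)
  have h2 : star X * (r₁ * star r₁ + r₂ * star r₂) * X ≤ star X * 1 * X :=
    star_left_conjugate_le_conjugate hr X
  have h3 : star (y₁ - star r₁ * X) * (y₁ - star r₁ * X) +
      star (y₂ - star r₂ * X) * (y₂ - star r₂ * X) =
      (star y₁ * y₁ + star y₂ * y₂) - star X * X - star X * X +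
        star X * (r₁ * star r₁ + r₂ * star r₂) * X := by
    have e : star X = star y₁ * star r₁ + star y₂ * star r₂ := by simp [hX]
    calc _ = (star y₁ * y₁ + star y₂ * y₂) - (star y₁ * star r₁ + star y₂ * star r₂) * X
          - star X * (r₁ * y₁ + r₂ * y₂) + star X * (r₁ * star r₁ + r₂ * star r₂) * X := by
          simp only [star_sub, star_mul, star_star]; noncomm_ring
      _ = _ := by rw [← e, ← hX]
  rw [h3] at h1
  rw [mul_one] at h2
  have h4 : star X * X ≤ star y₁ * y₁ + star y₂ * y₂ := by
    have h5 := add_le_add h1 h2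
    rw [← sub_nonneg] at h5 ⊢
    convert h5 using 1
    noncomm_ring
  exact h4.trans hy

/-- Orthogonal sums have norm equal to the maximum. -/
theorem norm_sq_add_le_of_orthogonal {n₁ n₂ : A} (h₁ : star n₁ * n₂ = 0) (h₂ : n₁ * star n₂ = 0)
    {M : ℝ} (hn₁ : ‖n₁‖ ^ 2 ≤ M) (hn₂ : ‖n₂‖ ^ 2 ≤ M) : ‖n₁ + n₂‖ ^ 2 ≤ M := by
  have h₁' : star n₂ * n₁ = 0 := by simpa using congrArg star h₁
  have h₂' : n₂ * star n₁ = 0 := by simpa using congrArg star h₂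
  set x := star n₁ * n₁ + star n₂ * n₂ with hx
  have e : star (n₁ + n₂) * (n₁ + n₂) = x := by
    rw [star_add, add_mul, mul_add, mul_add, h₁, h₁', hx]; simp
  have hx0 : 0 ≤ x := by rw [← e]; exact star_mul_self_nonneg _
  have hM : 0 ≤ M := (sq_nonneg _).trans hn₁
  have key : ∀ n : A, ‖n‖ ^ 2 ≤ M → star n * (n * star n) * n ≤ M • (star n * n) := by
    intro n hn
    have := star_left_conjugate_le_conjugate ((mul_star_self_le_sq_smul_one
      (x := n) (r := √M) (Real.le_sqrt_of_sq_le hn))) n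
    rw [Real.sq_sqrt hM] at this
    simpa using this
  have hxx : star x * x ≤ M • x := by
    have : star x * x = star n₁ * (n₁ * star n₁) * n₁ + star n₂ * (n₂ * star n₂) * n₂ := by
      rw [hx]
      simp only [star_add, star_mul, star_star, mul_add, add_mul]
      have a1 : star n₂ * n₂ * (star n₁ * n₁) = star n₂ * (n₂ * star n₁) * n₁ := by noncomm_ring
      have a2 : star n₁ * n₁ * (star n₂ * n₂) = star n₁ * (n₁ * star n₂) * n₂ := by noncomm_ring
      rw [a1, a2, h₂, h₂']
      noncomm_ring
    rw [this, hx, smul_add]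
    exact add_le_add (key _ hn₁) (key _ hn₂)
  have h3 := norm_sq_le_of_star_mul_self_le hxx
  rw [norm_smul, Real.norm_of_nonneg hM] at h3
  have h4 : ‖n₁ + n₂‖ ^ 2 = ‖x‖ := by rw [← e, CStarRing.norm_star_mul_self, sq]
  rw [h4]
  by_contra! hlt
  nlinarith

theorem sq_le_self_of_norm_le_one {b : A} (h0 : 0 ≤ b) (h1 : ‖b‖ ≤ 1) : b * b ≤ b := by
  have hb : b ≤ 1 := (CStarAlgebra.norm_le_one_iff_of_nonneg b h0).1 h1
  have hs : CFC.sqrt b * CFC.sqrt b = b := CFC.sqrt_mul_sqrt_self b h0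
  have hsa : star (CFC.sqrt b) = CFC.sqrt b := (CFC.sqrt_nonneg b).isSelfAdjoint
  have := star_left_conjugate_le_conjugate hb (CFC.sqrt b)
  rw [hsa, mul_one, hs] at this
  calc b * b = CFC.sqrt b * (CFC.sqrt b * CFC.sqrt b) * CFC.sqrt b := by
        nth_rewrite 1 2 [← hs]; noncomm_ring
    _ ≤ b := by rwa [hs]

/-- For `0 ≤ b ≤ 1`, `b² + (1 - b)² ≤ 1`. -/
theorem sq_add_one_sub_sq_le {b : A} (h0 : 0 ≤ b) (h1 : ‖b‖ ≤ 1) :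
    b * b + (1 - b) * (1 - b) ≤ 1 := by
  have := sq_le_self_of_norm_le_one h0 h1
  rw [← sub_nonneg] at this ⊢
  have h2 := add_nonneg this this
  convert h2 using 1
  noncomm_ring

theorem one_sub_sq_le {b : A} (h0 : 0 ≤ b) (h1 : ‖b‖ ≤ 1) :
    (1 - b) * (1 - b) ≤ 1 - b * b := by
  have := sq_add_one_sub_sq_le h0 h1
  rwa [add_comm, ← le_sub_iff_add_le] at this

theorem norm_one_sub_le {b : A} (h0 : 0 ≤ b) (h1 : ‖b‖ ≤ 1) : ‖1 - b‖ ≤ 1 := by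
  have hb : star b = b := h0.isSelfAdjoint
  rw [norm_le_one_iff_star_mul_self_le, star_sub, star_one, hb]
  refine (one_sub_sq_le h0 h1).trans ?_
  have : 0 ≤ star b * b := star_mul_self_nonneg b
  rw [hb] at this
  simpa using this

end CStarBasics

section Bump

/-- A piecewise linear bump that vanishes below `1 - ε` and equals one above `1 - ε / 2`. -/
noncomputable def bumpFun (ε t : ℝ) : ℝ := max 0 (min 1 ((t - (1 - ε)) * (2 / ε)))

theorem continuous_bumpFun (ε : ℝ) : Continuous (bumpFun ε) := by
  unfold bumpFun; fun_prop

theorem bumpFun_nonneg (ε t : ℝ) : 0 ≤ bumpFun ε t := le_max_left _ _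

theorem bumpFun_le_one (ε t : ℝ) : bumpFun ε t ≤ 1 := max_le zero_le_one (min_le_left _ _)

theorem bumpFun_eq_zero {ε t : ℝ} (hε : 0 < ε) (h : t ≤ 1 - ε) : bumpFun ε t = 0 :=
  max_eq_left ((min_le_right _ _).trans
    (mul_nonpos_of_nonpos_of_nonneg (by linarith) (by positivity)))

theorem bumpFun_eq_one {ε t : ℝ} (hε : 0 < ε) (h : 1 - ε / 2 ≤ t) : bumpFun ε t = 1 := by
  have : 1 ≤ (t - (1 - ε)) * (2 / ε) := by
    rw [mul_div_assoc', le_div_iff₀ hε]; linarith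
  rw [bumpFun, min_eq_left this, max_eq_right zero_le_one]

variable {A : Type*} [CStarAlgebra A] [PartialOrder A] [StarOrderedRing A]

theorem one_mem_spectrum {K : A} (hK : 0 ≤ K) (hK1 : ‖K‖ = 1) : (1 : ℝ) ∈ spectrum ℝ K := by
  have : Nontrivial A := ⟨K, 0, fun h => by simp [h] at hK1⟩
  have := CStarAlgebra.norm_mem_spectrum_of_nonneg (a := K) hK
  rwa [hK1] at this

theorem spectrum_subset_Icc {K : A} (hK : 0 ≤ K) (hK1 : ‖K‖ = 1) {t : ℝ}
    (ht : t ∈ spectrum ℝ K) : t ∈ Icc (0 : ℝ) 1 := by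
  have : Nontrivial A := ⟨K, 0, fun h => by simp [h] at hK1⟩
  refine ⟨spectrum_nonneg_of_nonneg hK ht, ?_⟩
  have := spectrum.norm_le_norm_of_mem ht
  rw [hK1] at this
  exact (le_abs_self t).trans this

/-- Spectral cut-offs of a positive element of norm one near the top of its spectrum. -/
theorem exists_bump {K : A} (hK : 0 ≤ K) (hK1 : ‖K‖ = 1) {ε : ℝ} (hε : 0 < ε) (hε2 : ε ≤ 1 / 2) :
    0 ≤ cfc (bumpFun ε) K ∧ ‖cfc (bumpFun ε) K‖ ≤ 1 ∧ (∃ g, cfc (bumpFun ε) K = K * g) ∧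
      (∃ c, c ≠ 0 ∧ cfc (bumpFun ε) K * c = c) ∧
      ‖cfc (bumpFun ε) K * (1 - K) * cfc (bumpFun ε) K‖ ≤ ε := by
  have hsa : IsSelfAdjoint K := hK.isSelfAdjoint
  have hc : ∀ δ, ContinuousOn (bumpFun δ) (spectrum ℝ K) :=
    fun δ => (continuous_bumpFun δ).continuousOn
  refine ⟨cfc_nonneg fun t _ => bumpFun_nonneg _ _, ?_, ?_, ?_, ?_⟩
  · refine norm_cfc_le zero_le_one fun t _ => ?_
    rw [Real.norm_of_nonneg (bumpFun_nonneg _ _)]; exact bumpFun_le_one _ _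
  · refine ⟨cfc (fun t => bumpFun ε t / max t (1 / 2)) K, ?_⟩
    have hcg : ContinuousOn (fun t : ℝ => bumpFun ε t / max t (1 / 2)) (spectrum ℝ K) :=
      ((continuous_bumpFun ε).div (by fun_prop) fun t => by positivity).continuousOn
    have h1 : cfc (fun t => t * (bumpFun ε t / max t (1 / 2))) K =
        K * cfc (fun t => bumpFun ε t / max t (1 / 2)) K := by
      rw [cfc_mul (fun t => t) _ K (by fun_prop) hcg, cfc_id' ℝ K]
    rw [← h1]
    refine cfc_congr fun t _ => ?_
    rcases le_total t (1 - ε) with h | h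
    · simp [bumpFun_eq_zero hε h]
    · have ht : 1 / 2 ≤ t := by linarith
      simp only [max_eq_left ht]
      field_simp
  · refine ⟨cfc (bumpFun (ε / 2)) K, fun h => ?_, ?_⟩
    · have := norm_apply_le_norm_cfc (bumpFun (ε / 2)) K (one_mem_spectrum hK hK1) (hc _)
      rw [h, norm_zero, bumpFun_eq_one (by positivity) (by linarith)] at this
      norm_num at this
    · rw [← cfc_mul _ _ K (hc _) (hc _)]
      refine cfc_congr fun t _ => ?_
      rcases le_total t (1 - ε / 2) with h | h
      · simp [bumpFun_eq_zero (half_pos hε) h]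
      · simp [bumpFun_eq_one hε h]
  · have e : cfc (bumpFun ε) K * (1 - K) * cfc (bumpFun ε) K =
        cfc (fun t => bumpFun ε t * (1 - t) * bumpFun ε t) K := by
      rw [cfc_mul _ _ K (by have := hc ε; fun_prop) (hc _), cfc_mul _ _ K (hc _) (by fun_prop),
        cfc_sub _ _ K (by fun_prop) (by fun_prop), cfc_const_one ℝ K, cfc_id' ℝ K]
    rw [e]
    refine norm_cfc_le hε.le fun t ht => ?_
    obtain ⟨h0, h1⟩ := spectrum_subset_Icc hK hK1 ht
    have b0 := bumpFun_nonneg ε t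
    have b1 := bumpFun_le_one ε t
    rw [Real.norm_of_nonneg (by have : 0 ≤ 1 - t := by linarith
                                positivity)]
    rcases le_total t (1 - ε) with h | h
    · simp [bumpFun_eq_zero hε h, hε.le]
    · calc bumpFun ε t * (1 - t) * bumpFun ε t ≤ 1 * ε * 1 := by
            gcongr; linarith
        _ = ε := by ring

end Bump

section Region

variable {A : Type*} [CStarAlgebra A] [PartialOrder A] [StarOrderedRing A]

/-- A positive contraction `b` on which `D` acts as a unit, and which acts itself as a unit on
some nonzero element. -/
structure IsRegion (D b : A) : Prop where
  nonneg : 0 ≤ b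
  norm_le : ‖b‖ ≤ 1
  left_unit : D * b = b
  plateau : ∃ c, c ≠ 0 ∧ b * c = c

namespace IsRegion

variable {D e b : A}

theorem star_eq (hb : IsRegion D b) : star b = b := hb.nonneg.isSelfAdjoint

theorem mul_right_unit (hb : IsRegion D b) (he : IsRegion D e) (h : e * b = b) : b * e = b := by
  simpa [hb.star_eq, he.star_eq] using congrArg star h

theorem right_unit (hb : IsRegion D b) (hD : star D = D) : b * D = b := by
  simpa [hb.star_eq, hD] using congrArg star hb.left_unit

theorem norm_mul_self (hb : IsRegion D b) : ‖b * b‖ = 1 := by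
  obtain ⟨c, hc, h⟩ := hb.plateau
  refine le_antisymm ((norm_mul_le _ _).trans
    (mul_le_one₀ hb.norm_le (norm_nonneg _) hb.norm_le)) ?_
  have := norm_mul_le (b * b) c
  rw [mul_assoc, h, h] at this
  have hc' : 0 < ‖c‖ := norm_pos_iff.2 hc
  nlinarith

theorem exists_of_bump {K : A} (hK : 0 ≤ K) (hK1 : ‖K‖ = 1) (hDK : D * K = K) {ε : ℝ}
    (hε : 0 < ε) (hε2 : ε ≤ 1 / 2) :
    ∃ b, IsRegion D b ∧ (∃ g, b = K * g) ∧ ‖b * (1 - K) * b‖ ≤ ε := by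
  obtain ⟨h0, h1, ⟨g, hg⟩, h3, h4⟩ := exists_bump hK hK1 hε hε2
  exact ⟨_, ⟨h0, h1, by rw [hg, ← mul_assoc, hDK], h3⟩, ⟨g, hg⟩, h4⟩

theorem exists_sub (he : IsRegion D e) : ∃ b, IsRegion D b ∧ e * b = b := by
  obtain ⟨c, hc, h⟩ := he.plateau
  have hn : ‖c * star c‖ ≠ 0 := by
    rw [CStarRing.norm_self_mul_star]; simpa using hc
  obtain ⟨b, hb, ⟨g, hg⟩, -⟩ := exists_of_bump (D := D) (K := ‖c * star c‖⁻¹ • (c * star c))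
    (smul_nonneg (by positivity) (mul_star_self_nonneg c))
    (by rw [norm_smul, norm_inv, norm_norm, inv_mul_cancel₀ hn])
    (by
      rw [mul_smul_comm, ← mul_assoc]
      congr 2
      rw [← h, ← mul_assoc, he.left_unit])
    (ε := 1 / 2) (by norm_num) le_rfl
  refine ⟨b, hb, ?_⟩
  rw [hg, ← mul_assoc, mul_smul_comm, ← mul_assoc, h]

theorem sub_trans {b' : A} (h : e * b = b) (h' : b * b' = b') : e * b' = b' := by
  rw [← h', ← mul_assoc, h]

/-- Compressing to a smaller region does not increase norms. -/
theorem norm_compress_le (hb : IsRegion D b) (he : IsRegion D e) (h : e * b = b) (x : A) (α : ℂ) :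
    ‖b * x * b - α • (b * b)‖ ≤ ‖e * x * e - α • (e * e)‖ := by
  have h' := hb.mul_right_unit he h
  have e1 : b * x * b - α • (b * b) = b * (e * x * e - α • (e * e)) * b := by
    have : b * (e * x * e - α • (e * e)) * b = (b * e) * x * (e * b) -
        α • ((b * e) * (e * b)) := by
      simp only [mul_sub, sub_mul, mul_assoc, mul_smul_comm, smul_mul_assoc]
    rw [this, h, h']
  rw [e1]
  calc _ ≤ ‖b‖ * ‖e * x * e - α • (e * e)‖ * ‖b‖ := norm_mul₃_le
    _ ≤ 1 * ‖e * x * e - α • (e * e)‖ * 1 := by gcongr <;> exact hb.norm_le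
    _ = _ := by ring

end IsRegion

end Region

section Polar

variable {A : Type*} [CStarAlgebra A] [PartialOrder A] [StarOrderedRing A]

/-- A substitute for the polar decomposition of a nonzero `q`: a contraction `W` in `q A` with
`W* W` in `A q` that acts on a region like a partial isometry with `W* q` bounded below. -/
theorem exists_polar {q : A} (hq : q ≠ 0) :
    ∃ W b : A, ‖W‖ ≤ 1 ∧ IsRegion (star W * W) b ∧ (∃ u, W = q * u) ∧ (∃ u, star W * W = u * q) ∧
      (‖q‖ / 2) • (star W * W) ≤ star W * q := by
  have hq0 : 0 < ‖q‖ := norm_pos_iff.2 hq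
  set p : A := ‖q‖⁻¹ • q with hp
  have hqp : q = ‖q‖ • p := by rw [hp, smul_smul, mul_inv_cancel₀ hq0.ne', one_smul]
  set K : A := star p * p with hKdef
  have hK : 0 ≤ K := star_mul_self_nonneg p
  have hK1 : ‖K‖ = 1 := by
    rw [hKdef, CStarRing.norm_star_mul_self, hp, norm_smul, norm_inv, norm_norm,
      inv_mul_cancel₀ hq0.ne', one_mul]
  have hsa : IsSelfAdjoint K := hK.isSelfAdjoint
  set ρ : ℝ → ℝ := fun t => (√(max t (1 / 2)))⁻¹ with hρ
  have hpos : ∀ t : ℝ, 0 < √(max t (1 / 2)) := fun t => Real.sqrt_pos.2 (by positivity)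
  have hρc : Continuous ρ := by
    refine Continuous.inv₀ (by fun_prop) fun t => (hpos t).ne'
  have hρco : ContinuousOn ρ (spectrum ℝ K) := hρc.continuousOn
  set r : A := cfc ρ K with hr
  have hrs : star r = r := (cfc_predicate ρ K : IsSelfAdjoint r)
  have hrK : r * K = cfc (fun t => ρ t * t) K := by
    rw [cfc_mul ρ (fun t => t) K hρco (by fun_prop), cfc_id' ℝ K]
  have hrKr : r * K * r = cfc (fun t => ρ t * t * ρ t) K := by
    rw [hrK, cfc_mul (fun t => ρ t * t) ρ K (by fun_prop) hρco]
  have hcomm : K * r = r * K := by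
    rw [hrK, cfc_congr (g := fun t => t * ρ t) (fun t _ => mul_comm _ _),
      cfc_mul (fun t => t) ρ K (by fun_prop) hρco, cfc_id' ℝ K]
  have hD : star (p * r) * (p * r) = r * K * r := by
    rw [star_mul, hrs, hKdef]; noncomm_ring
  have hval : ∀ t, ρ t * t * ρ t = t / max t (1 / 2) := by
    intro t
    have : √(max t (1 / 2)) * √(max t (1 / 2)) = max t (1 / 2) :=
      Real.mul_self_sqrt (by positivity)
    calc ρ t * t * ρ t = t * (√(max t (1 / 2)) * √(max t (1 / 2)))⁻¹ := by
          rw [hρ, mul_inv]; ring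
      _ = t / max t (1 / 2) := by rw [this]; exact (div_eq_mul_inv _ _).symm
  obtain ⟨h0, h1, -, h3, -⟩ := exists_bump hK hK1 (ε := 1 / 2) (by norm_num) le_rfl
  refine ⟨p * r, cfc (bumpFun (1 / 2)) K, ?_, ⟨h0, h1, ?_, h3⟩, ?_, ?_, ?_⟩
  · rw [← sq_le_one_iff₀ (norm_nonneg _), sq, ← CStarRing.norm_star_mul_self, hD, hrKr]
    refine norm_cfc_le zero_le_one fun t ht => ?_
    obtain ⟨t0, -⟩ := spectrum_subset_Icc hK hK1 ht
    rw [hval, Real.norm_of_nonneg (by positivity)]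
    exact div_le_one_of_le₀ (le_max_left _ _) (by positivity)
  · rw [hD, hrKr, ← cfc_mul _ _ K (by fun_prop) (continuous_bumpFun _).continuousOn]
    refine cfc_congr fun t _ => ?_
    simp only [hval]
    rcases le_total t (1 / 2) with h | h
    · rw [bumpFun_eq_zero (by norm_num) (by linarith)]; simp
    · rw [max_eq_left h, div_self (by positivity), one_mul]
  · exact ⟨‖q‖⁻¹ • r, by rw [hp, mul_smul_comm, smul_mul_assoc]⟩
  · refine ⟨‖q‖⁻¹ • (r * r * star p), ?_⟩
    rw [hD, mul_assoc, hcomm, smul_mul_assoc, ← mul_smul_comm, ← hp, hKdef]; noncomm_ring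
  · have e1 : star (p * r) * q = ‖q‖ • (r * K) := by
      calc star (p * r) * q = star (p * r) * (‖q‖ • p) := by rw [← hqp]
        _ = ‖q‖ • (r * K) := by rw [star_mul, hrs, mul_smul_comm, mul_assoc]
    rw [e1, hD, hrKr, hrK, ← cfc_smul _ _ K (by fun_prop), ← cfc_smul _ _ K (by fun_prop)]
    refine cfc_mono (fun t ht => ?_) (by fun_prop) (by fun_prop)
    obtain ⟨t0, -⟩ := spectrum_subset_Icc hK hK1 ht
    have hρ2 : ρ t ≤ 2 := by
      rw [hρ]
      refine inv_le_of_inv_le₀ (by norm_num) ?_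
      refine Real.le_sqrt_of_sq_le ?_
      refine le_trans ?_ (le_max_right _ _)
      norm_num
    have hρ0 : 0 ≤ ρ t := by rw [hρ]; exact (inv_pos.2 (hpos t)).le
    simp only [smul_eq_mul]
    have : 0 ≤ ‖q‖ * (ρ t * t) * (2 - ρ t) := by
      have : 0 ≤ 2 - ρ t := by linarith
      positivity
    nlinarith

end Polar

section Excision

variable {A : Type*} [CStarAlgebra A] [PartialOrder A] [StarOrderedRing A] {D e : A}

/-- Selfadjoint elements are approximately scalar on a suitable smaller region. -/
theorem IsRegion.excision_selfAdjoint (he : IsRegion D e) {x : A} (hx : IsSelfAdjoint x)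
    {θ : ℝ} (hθ : 0 < θ) :
    ∃ (b : A) (t : ℝ), IsRegion D b ∧ e * b = b ∧ ‖b * x * b - (t : ℂ) • (b * b)‖ ≤ θ := by
  set M : ℝ := ‖x‖ + 1 with hM
  set G : A := x + M • (1 : A) with hG
  have hGsa : star G = G := by simp [hG, hx.star_eq]
  have hG1 : 1 ≤ G := by
    have := hx.neg_algebraMap_norm_le_self
    rw [Algebra.algebraMap_eq_smul_one] at this
    rw [hG, hM, add_smul, one_smul, ← sub_nonneg]
    rw [← sub_nonneg] at this
    convert this using 1; abel
  set Γ : ℝ := ‖G‖ + 1 with hΓ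
  have hΓ1 : 1 ≤ Γ := by rw [hΓ]; linarith [norm_nonneg G]
  have hGΓ : ‖G‖ ≤ Γ := by rw [hΓ]; linarith
  set S : Set ℝ := {n | ∃ b, IsRegion D b ∧ e * b = b ∧ n = ‖b * G * b‖} with hS
  have hlow : ∀ b, IsRegion D b → 1 ≤ ‖b * G * b‖ := by
    intro b hb
    have := star_left_conjugate_le_conjugate hG1 b
    rw [hb.star_eq, mul_one] at this
    rw [← hb.norm_mul_self]
    refine CStarAlgebra.norm_le_norm_of_nonneg_of_le ?_ this
    have := star_mul_self_nonneg b
    rwa [hb.star_eq] at this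
  have hbdd : BddBelow S := ⟨0, by rintro n ⟨b, -, -, rfl⟩; exact norm_nonneg _⟩
  have hne : S.Nonempty := by
    obtain ⟨b, hb, hb'⟩ := he.exists_sub
    exact ⟨_, b, hb, hb', rfl⟩
  set δ : ℝ := min 1 (θ / (4 * Γ)) with hδ
  have hδ0 : 0 < δ := by rw [hδ]; positivity
  have hδ1 : δ ≤ 1 := min_le_left _ _
  have hδΓ : 4 * Γ * δ ≤ θ := by
    have : δ ≤ θ / (4 * Γ) := min_le_right _ _
    rwa [le_div_iff₀ (by positivity), mul_comm] at this
  set ε : ℝ := δ ^ 2 / 2 with hε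
  have hε0 : 0 < ε := by positivity
  have hε2 : ε ≤ 1 / 2 := by rw [hε]; nlinarith
  obtain ⟨n, ⟨b₁, hb₁, heb₁, rfl⟩, hn⟩ := exists_lt_of_csInf_lt hne
    (show sInf S < sInf S + ε by linarith)
  obtain ⟨b₂, hb₂, hb₁₂⟩ := hb₁.exists_sub
  have heb₂ : e * b₂ = b₂ := sub_trans heb₁ hb₁₂
  have hb₂₁ := hb₂.mul_right_unit hb₁ hb₁₂
  set H : A := b₂ * G * b₂ with hH
  set h : ℝ := ‖H‖ with hh
  set n₁ : ℝ := ‖b₁ * G * b₁‖ with hn₁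
  have hNh : sInf S ≤ h := csInf_le hbdd ⟨b₂, hb₂, heb₂, rfl⟩
  have hh1 : 1 ≤ h := hlow b₂ hb₂
  have hn1 : 1 ≤ n₁ := hlow b₁ hb₁
  have hHeq : H = b₂ * (b₁ * G * b₁) * b₂ := by
    calc H = (b₂ * b₁) * G * (b₁ * b₂) := by rw [hb₂₁, hb₁₂]
      _ = _ := by noncomm_ring
  have hGsa₁ : IsSelfAdjoint (b₁ * G * b₁) := by
    rw [IsSelfAdjoint]; simp [hGsa, hb₁.star_eq, mul_assoc]
  have hHle : H ≤ n₁ • (b₂ * b₂) := by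
    have := star_left_conjugate_le_conjugate hGsa₁.le_algebraMap_norm_self b₂
    rw [hb₂.star_eq, Algebra.algebraMap_eq_smul_one, ← hHeq] at this
    simpa using this
  have hhΓ : h ≤ Γ := by
    calc h ≤ ‖b₂‖ * ‖G‖ * ‖b₂‖ := norm_mul₃_le
      _ ≤ 1 * ‖G‖ * 1 := by gcongr <;> exact hb₂.norm_le
      _ ≤ Γ := by linarith
  have hH0 : 0 ≤ H := by
    have := star_left_conjugate_nonneg (zero_le_one.trans hG1) b₂
    rwa [hb₂.star_eq] at this
  obtain ⟨b, hb, ⟨g, hg⟩, hbump⟩ := IsRegion.exists_of_bump (D := D) (K := h⁻¹ • H)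
    (smul_nonneg (by positivity) hH0)
    (by rw [norm_smul, norm_inv, Real.norm_of_nonneg (by linarith), ← hh,
          inv_mul_cancel₀ (by linarith)])
    (by rw [mul_smul_comm, hH, ← mul_assoc, ← mul_assoc, hb₂.left_unit]) hε0 hε2
  have hb₁b : b₁ * b = b := by
    rw [hg, ← mul_assoc, mul_smul_comm, hH, ← mul_assoc, ← mul_assoc, hb₁₂]
  refine ⟨b, h - M, hb, sub_trans heb₁ hb₁b, ?_⟩
  set d : A := (1 - b₂) * b with hd
  have hds : star d = b * (1 - b₂) := by simp [hd, hb.star_eq, hb₂.star_eq]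
  have hbound1 : ‖b * (H - h • (1 : A)) * b‖ ≤ h * ε := by
    have : b * (H - h • (1 : A)) * b = (-h) • (b * (1 - h⁻¹ • H) * b) := by
      have hh0 : h ≠ 0 := by linarith
      have e2 : H - h • (1 : A) = (-h) • (1 - h⁻¹ • H) := by
        rw [smul_sub, smul_smul, neg_mul, mul_inv_cancel₀ hh0]; module
      rw [e2, mul_smul_comm, smul_mul_assoc]
    rw [this, norm_smul, norm_neg, Real.norm_of_nonneg (by linarith)]
    gcongr
  have hdn : ‖d‖ ≤ δ := by
    have h1 : star d * d ≤ b * (1 - h⁻¹ • H) * b + (h⁻¹ - n₁⁻¹) • (b * H * b) := by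
      have s1 : (1 - b₂) * (1 - b₂) ≤ 1 - n₁⁻¹ • H := by
        refine (one_sub_sq_le hb₂.nonneg hb₂.norm_le).trans ?_
        have : n₁⁻¹ • H ≤ n₁⁻¹ • (n₁ • (b₂ * b₂)) :=
          smul_le_smul_of_nonneg_left hHle (by positivity)
        rw [smul_smul, inv_mul_cancel₀ (by linarith), one_smul] at this
        exact sub_le_sub_left this 1
      have s2 := star_left_conjugate_le_conjugate s1 b
      rw [hb.star_eq] at s2
      calc star d * d = b * ((1 - b₂) * (1 - b₂)) * b := by rw [hds, hd]; noncomm_ring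
        _ ≤ b * (1 - n₁⁻¹ • H) * b := s2
        _ = _ := by
          simp only [mul_sub, sub_mul, mul_smul_comm, smul_mul_assoc, mul_one]
          module
    have h2 := norm_sq_le_of_star_mul_self_le h1
    have hhn : h ≤ n₁ := by
      have := CStarAlgebra.norm_le_norm_of_nonneg_of_le hH0 hHle
      rw [norm_smul, hb₂.norm_mul_self, mul_one, Real.norm_of_nonneg (by linarith)] at this
      exact this
    have hinv : 0 ≤ h⁻¹ - n₁⁻¹ := by
      rw [sub_nonneg]; exact inv_anti₀ (by linarith) hhn
    have h3 : ‖(h⁻¹ - n₁⁻¹) • (b * H * b)‖ ≤ ε := by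
      rw [norm_smul, Real.norm_of_nonneg hinv]
      have : ‖b * H * b‖ ≤ h := by
        calc ‖b * H * b‖ ≤ ‖b‖ * ‖H‖ * ‖b‖ := norm_mul₃_le
          _ ≤ 1 * ‖H‖ * 1 := by gcongr <;> exact hb.norm_le
          _ = h := by rw [← hh]; ring
      calc (h⁻¹ - n₁⁻¹) * ‖b * H * b‖ ≤ (h⁻¹ - n₁⁻¹) * h := by gcongr
        _ = (n₁ - h) / n₁ := by
          have : h ≠ 0 := by linarith
          have : n₁ ≠ 0 := by linarith
          field_simp
        _ ≤ n₁ - h := div_le_self (by linarith) hn1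
        _ ≤ ε := by linarith
    have h4 := norm_add_le (b * (1 - h⁻¹ • H) * b) ((h⁻¹ - n₁⁻¹) • (b * H * b))
    have h5 : ‖d‖ ^ 2 ≤ δ ^ 2 := by
      have : δ ^ 2 = ε + ε := by rw [hε]; ring
      linarith
    exact le_of_sq_le_sq h5 hδ0.le
  have hbound2 : ‖b * G * b - b * H * b‖ ≤ 2 * Γ * δ := by
    have e2 : b * G * b - b * H * b = b * G * d + star d * G * (b₂ * b) := by
      rw [hds, hd, hH]; noncomm_ring
    rw [e2]
    have t1 : ‖b * G * d‖ ≤ 1 * Γ * δ := norm_mul₃_le.trans (by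
      gcongr; exact hb.norm_le)
    have t2 : ‖star d * G * (b₂ * b)‖ ≤ δ * Γ * (1 * 1) := norm_mul₃_le.trans (by
      rw [norm_star]
      gcongr
      exact (norm_mul_le _ _).trans (by gcongr; exacts [hb₂.norm_le, hb.norm_le]))
    linarith [norm_add_le (b * G * d) (star d * G * (b₂ * b))]
  have e3 : b * x * b - ((h - M : ℝ) : ℂ) • (b * b) =
      (b * G * b - b * H * b) + b * (H - h • (1 : A)) * b := by
    rw [Complex.coe_smul, hG]
    simp only [mul_add, add_mul, mul_sub, sub_mul, mul_smul_comm, smul_mul_assoc, mul_one]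
    module
  push_cast at e3 ⊢
  rw [e3]
  have h6 := norm_add_le (b * G * b - b * H * b) (b * (H - h • (1 : A)) * b)
  have h7 : h * ε ≤ Γ * δ := by
    have : ε ≤ δ := by rw [hε]; nlinarith
    gcongr
  have h8 : 0 < Γ * δ := by positivity
  linarith

theorem IsRegion.excision_nonneg (he : IsRegion D e) {x : A} (hx : 0 ≤ x) {θ : ℝ} (hθ : 0 < θ) :
    ∃ (b : A) (t : ℝ), 0 ≤ t ∧ IsRegion D b ∧ e * b = b ∧
      ‖b * x * b - (t : ℂ) • (b * b)‖ ≤ θ := by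
  obtain ⟨b, t, hb, heb, h⟩ := he.excision_selfAdjoint hx.isSelfAdjoint hθ
  rcases le_total 0 t with ht | ht
  · exact ⟨b, t, ht, hb, heb, h⟩
  refine ⟨b, 0, le_rfl, hb, heb, le_trans ?_ h⟩
  have h1 := star_left_conjugate_nonneg hx b
  have h2 := star_mul_self_nonneg b
  rw [hb.star_eq] at h1 h2
  simp only [Complex.ofReal_zero, zero_smul, sub_zero]
  refine CStarAlgebra.norm_le_norm_of_nonneg_of_le h1 ?_
  rw [Complex.coe_smul, le_sub_iff_add_le]
  have := smul_nonneg (neg_nonneg.2 ht) h2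
  rw [neg_smul] at this
  simpa using this

theorem IsRegion.excision (he : IsRegion D e) (x : A) {θ : ℝ} (hθ : 0 < θ) :
    ∃ (b : A) (t : ℂ), IsRegion D b ∧ e * b = b ∧ ‖b * x * b - t • (b * b)‖ ≤ θ := by
  obtain ⟨b₁, t₁, hb₁, he₁, h₁⟩ := he.excision_selfAdjoint (realPart x).2 (half_pos hθ)
  obtain ⟨b₂, t₂, hb₂, he₂, h₂⟩ := hb₁.excision_selfAdjoint (imaginaryPart x).2 (half_pos hθ)
  refine ⟨b₂, t₁ + Complex.I * t₂, hb₂, sub_trans he₁ he₂, ?_⟩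
  have e1 : b₂ * x * b₂ - ((t₁ : ℂ) + Complex.I * t₂) • (b₂ * b₂) =
      (b₂ * (realPart x : A) * b₂ - (t₁ : ℂ) • (b₂ * b₂)) +
      Complex.I • (b₂ * (imaginaryPart x : A) * b₂ - (t₂ : ℂ) • (b₂ * b₂)) := by
    conv_lhs => rw [← realPart_add_I_smul_imaginaryPart x]
    simp only [mul_add, add_mul, mul_smul_comm, smul_mul_assoc]
    module
  rw [e1]
  refine (norm_add_le _ _).trans ?_
  rw [norm_smul, Complex.norm_I, one_mul]
  linarith [hb₂.norm_compress_le hb₁ he₂ (realPart x : A) t₁]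

end Excision

section Sandwich

variable {A : Type*} [CStarAlgebra A] [PartialOrder A] [StarOrderedRing A]

theorem mul_mul_of_mul_eq {a b c : A} (h : a * b = c) (x : A) : a * (b * x) = c * x := by
  rw [← mul_assoc, h]

namespace IsRegion

variable {W b : A}

theorem unit_left (hb : IsRegion (star W * W) b) : star W * (W * b) = b := by
  rw [← mul_assoc, hb.left_unit]

theorem unit_left_assoc (hb : IsRegion (star W * W) b) (x : A) :
    star W * (W * (b * x)) = b * x := by
  rw [← mul_assoc W, ← mul_assoc, hb.unit_left]

theorem unit_right (hb : IsRegion (star W * W) b) : b * (star W * W) = b :=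
  hb.right_unit (by simp)

theorem unit_right_assoc (hb : IsRegion (star W * W) b) (x : A) :
    b * (star W * (W * x)) = b * x := by
  rw [← mul_assoc (star W), ← mul_assoc, hb.unit_right]

theorem conj_nonneg (hb : IsRegion (star W * W) b) : 0 ≤ W * b * star W :=
  star_right_conjugate_nonneg hb.nonneg W

theorem norm_conj_le (hb : IsRegion (star W * W) b) (hW : ‖W‖ ≤ 1) : ‖W * b * star W‖ ≤ 1 := by
  refine norm_mul₃_le.trans ?_
  rw [norm_star]
  have := hb.norm_le
  exact mul_le_one₀ (mul_le_one₀ hW (norm_nonneg _) this) (norm_nonneg _) hW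

end IsRegion

theorem norm_mul_le_of_left {x y : A} {r : ℝ} (hx : ‖x‖ ≤ 1) (hy : ‖y‖ ≤ r) : ‖x * y‖ ≤ r :=
  (norm_mul_le _ _).trans ((mul_le_of_le_one_left (norm_nonneg _) hx).trans hy)

theorem norm_mul_le_of_right {x y : A} {r : ℝ} (hx : ‖x‖ ≤ r) (hy : ‖y‖ ≤ 1) : ‖x * y‖ ≤ r :=
  (norm_mul_le _ _).trans ((mul_le_of_le_one_right (norm_nonneg _) hy).trans hx)

/-- The norm of `b² - α (2 b - b²)` for a positive contraction `b` and small `α`. -/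
theorem norm_sq_sub_smul_le {b : A} (h0 : 0 ≤ b) (h1 : ‖b‖ ≤ 1) {α : ℂ} (hα : ‖α‖ ≤ 1 / 2) :
    ‖b * b - α • (b + b - b * b)‖ ^ 2 ≤ (1 - α.re) ^ 2 + ‖α‖ ^ 2 := by
  have hbs : star b = b := h0.isSelfAdjoint
  have hsa : IsSelfAdjoint b := hbs
  set Q : A := b + b - b * b with hQ
  set C : A := b * b - α.re • Q with hC
  have hQs : star Q = Q := by simp [hQ, hbs]
  have hCs : star C = C := by simp [hC, hbs, hQs]
  have hbQ : b * b * Q = Q * (b * b) := by rw [hQ]; noncomm_ring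
  have hCQ : C * Q = Q * C := by
    rw [hC, sub_mul, hbQ, smul_mul_assoc, mul_sub Q (b * b), mul_smul_comm]
  have e1 : b * b - α • Q = C - (Complex.I * α.im) • Q := by
    rw [hC]
    nth_rewrite 1 [← Complex.re_add_im α]
    rw [add_smul, Complex.coe_smul, mul_comm (α.im : ℂ)]
    abel
  have e2 : star (b * b - α • Q) * (b * b - α • Q) = C * C + (α.im ^ 2) • (Q * Q) := by
    have e3 : star (C - (Complex.I * α.im) • Q) = C + (Complex.I * α.im) • Q := by
      rw [star_sub, hCs, star_smul, hQs]
      simp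
    rw [e1, e3]
    simp only [add_mul, mul_sub, smul_mul_assoc, mul_smul_comm, hCQ, smul_add, smul_smul]
    have : Complex.I * α.im * (Complex.I * α.im) = ((-(α.im ^ 2) : ℝ) : ℂ) := by
      push_cast; linear_combination ((α.im : ℂ) ^ 2) * Complex.I_sq
    rw [this, Complex.coe_smul]
    module
  have hQn : ‖Q‖ ≤ 1 := by
    have h2 : ‖1 - b‖ ≤ 1 := norm_one_sub_le h0 h1
    have h3 : 0 ≤ (1 - b) * (1 - b) := by
      have := star_mul_self_nonneg (1 - b)
      rwa [star_sub, star_one, hbs] at this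
    have := norm_one_sub_le h3 (norm_mul_le_of_left h2 h2)
    convert this using 2
    rw [hQ]; noncomm_ring
  have hre : |α.re| ≤ 1 / 2 := (Complex.abs_re_le_norm α).trans hα
  obtain ⟨ha, ha'⟩ := abs_le.1 hre
  have hCn : ‖C‖ ≤ 1 - α.re := by
    have e4 : C = cfc (fun t : ℝ => t * t - α.re * (t + t - t * t)) b := by
      rw [cfc_sub _ _ b (by fun_prop) (by fun_prop), cfc_mul _ _ b (by fun_prop) (by fun_prop),
        cfc_const_mul _ _ b (by fun_prop), cfc_sub _ _ b (by fun_prop) (by fun_prop),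
        cfc_add b _ _ (by fun_prop) (by fun_prop), cfc_mul _ _ b (by fun_prop) (by fun_prop),
        cfc_id' ℝ b]
    rw [e4]
    refine norm_cfc_le (by linarith) fun t ht => ?_
    have t0 : 0 ≤ t := spectrum_nonneg_of_nonneg h0 ht
    have t1 : t ≤ 1 := by
      rcases subsingleton_or_nontrivial A with _ | _
      · simp [spectrum.of_subsingleton] at ht
      exact (le_abs_self t).trans ((spectrum.norm_le_norm_of_mem ht).trans h1)
    rw [Real.norm_eq_abs, abs_le]
    constructor
    · have : 0 ≤ 1 + 2 * t - t ^ 2 := by nlinarith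
      nlinarith [mul_nonneg (sub_nonneg.2 ha') this, sq_nonneg (3 * t - 1)]
    · have : 0 ≤ (1 - t) * ((1 + t) - α.re * (1 - t)) := by
        refine mul_nonneg (by linarith) ?_
        nlinarith [mul_nonneg (sub_nonneg.2 ha') (sub_nonneg.2 t1)]
      nlinarith
  calc ‖b * b - α • Q‖ ^ 2 = ‖C * C + (α.im ^ 2) • (Q * Q)‖ := by
        rw [← e2, CStarRing.norm_star_mul_self, sq]
    _ ≤ ‖C‖ * ‖C‖ + α.im ^ 2 * (‖Q‖ * ‖Q‖) := by
        refine (norm_add_le _ _).trans (add_le_add (norm_mul_le _ _) ?_)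
        rw [norm_smul, Real.norm_of_nonneg (sq_nonneg _)]
        gcongr
        exact norm_mul_le _ _
    _ ≤ (1 - α.re) * (1 - α.re) + α.im ^ 2 * (1 * 1) := by gcongr; linarith
    _ ≤ (1 - α.re) ^ 2 + ‖α‖ ^ 2 := by
        have : α.im ^ 2 ≤ ‖α‖ ^ 2 := by
          rw [← sq_abs]; gcongr; exact Complex.abs_im_le_norm α
        linarith

theorem exists_contraction_near {W e b b' z : A} (hW : ‖W‖ ≤ 1) (he : IsRegion (star W * W) e)
    (hb : IsRegion (star W * W) b) (heb : e * b = b)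
    (hbb' : b * b' = b') (hz : ‖z‖ ≤ 1) {α : ℂ} {θ ρ : ℝ}
    (hθ : ‖e * (star W * z) * e - α • (e * e)‖ ≤ θ) (hrow : ‖b * (star W * z)‖ ≤ ρ)
    (hcol : ‖z * b‖ ≤ ρ) (hα : ‖α‖ ≤ ρ) (hρ : ρ ≤ 1 / 2) :
    ∃ x, ‖x‖ ≤ 1 ∧ x * b' = W * b' ∧ ‖z - x‖ ≤ 1 - α.re + 3 * ρ ^ 2 + 4 * θ := by
  have hbe := hb.mul_right_unit he heb
  have hes := he.star_eq
  have hbs := hb.star_eq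
  have hρ0 : 0 ≤ ρ := (norm_nonneg _).trans hα
  have hθ0 : 0 ≤ θ := (norm_nonneg _).trans hθ
  set B : A := W * b * star W with hB
  have hBs : star B = B := by simp [hB, hbs, mul_assoc]
  have hB0 : 0 ≤ B := hb.conj_nonneg
  have hB1 : ‖B‖ ≤ 1 := hb.norm_conj_le hW
  have hBB : B * B = W * b * star (W * b) := by
    rw [hB, star_mul, hbs]
    simp only [mul_assoc, hb.unit_left_assoc]
  refine ⟨W * b * b + (1 - B) * (z * (1 - b)), ?_, ?_, ?_⟩
  · refine norm_row_mul_column_le ?_ ?_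
    · rw [← hBB, star_sub, star_one, hBs]
      exact sq_add_one_sub_sq_le hB0 hB1
    · have h1 := star_left_conjugate_le_conjugate (star_mul_self_le_one hz) (1 - b)
      rw [star_sub, star_one, hbs, mul_one] at h1
      rw [hbs, star_mul, star_sub, star_one, hbs]
      refine le_trans ?_ (sq_add_one_sub_sq_le hb.nonneg hb.norm_le)
      refine add_le_add le_rfl ?_
      convert h1 using 1
      noncomm_ring
  · simp only [add_mul, mul_assoc, sub_mul, one_mul, hbb', sub_self, mul_zero, add_zero]
  set R : A := e * (star W * z) * e - α • (e * e) with hR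
  set c : A := b * b - α • (b + b - b * b) with hc
  set n₁ : A := B * (z * (1 - e)) with hn₁
  set n₂ : A := (1 - W * e * star W) * (z * b) with hn₂
  have hce : c * e = c := by
    rw [hc]
    simp only [sub_mul, add_mul, smul_mul_assoc, mul_assoc, hbe]
  have hec : star c * e = star c := by
    have hec' : e * c = c := by
      rw [hc]
      simp only [mul_sub, mul_add, mul_smul_comm, ← mul_assoc, heb]
    simpa [hes] using congrArg star hec'
  have hDc : star W * (W * c) = c := by
    rw [hc]
    simp only [mul_sub, mul_add, mul_smul_comm, hb.unit_left, hb.unit_left_assoc]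
  have hdec : z - (W * b * b + (1 - B) * (z * (1 - b))) =
      -(W * c - n₁ - n₂) + (W * b * R + W * R * b - W * b * R * b) := by
    rw [hc, hn₁, hn₂, hR, hB]
    simp only [mul_add, mul_sub, sub_mul, mul_assoc, smul_mul_assoc, mul_smul_comm,
      mul_one, one_mul, heb, hbe, mul_mul_of_mul_eq hbe]
    module
  have herr : ‖W * b * R + W * R * b - W * b * R * b‖ ≤ 3 * θ := by
    have hWb : ‖W * b‖ ≤ 1 := norm_mul_le_of_left hW hb.norm_le
    have t1 : ‖W * b * R‖ ≤ θ := norm_mul_le_of_left hWb hθ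
    have t2 : ‖W * R * b‖ ≤ θ := norm_mul_le_of_right (norm_mul_le_of_left hW hθ) hb.norm_le
    have t3 : ‖W * b * R * b‖ ≤ θ := norm_mul_le_of_right t1 hb.norm_le
    linarith [norm_sub_le (W * b * R + W * R * b) (W * b * R * b),
      norm_add_le (W * b * R) (W * R * b)]
  have hn₁le : ‖n₁‖ ≤ ρ := by
    rw [hn₁, hB, ← mul_assoc, mul_assoc (W * b), mul_assoc W]
    exact norm_mul_le_of_right (norm_mul_le_of_left hW hrow) (norm_one_sub_le he.nonneg he.norm_le)
  have hn₂le : ‖n₂‖ ≤ ρ :=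
    norm_mul_le_of_left (norm_one_sub_le he.conj_nonneg (he.norm_conj_le hW)) hcol
  have hcn₁ : W * c * star n₁ = 0 := by
    rw [hn₁]
    simp only [star_mul, star_sub, star_one, hes, mul_assoc]
    rw [← mul_assoc c, mul_sub, mul_one, hce, sub_self, zero_mul, mul_zero]
  have hn₁c : n₁ * star (W * c) = 0 := by simpa using congrArg star hcn₁
  have hPn₂ : star (W * c - n₁) * n₂ = 0 := by
    have a1 : star c * (star W * (1 - W * e * star W)) = 0 := by
      simp only [mul_sub, mul_one, mul_assoc, he.unit_left_assoc, mul_mul_of_mul_eq hec, sub_self]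
    have a2 : B * (1 - W * e * star W) = 0 := by
      rw [hB]
      simp only [mul_sub, mul_one, mul_assoc, he.unit_left_assoc, mul_mul_of_mul_eq hbe, sub_self]
    rw [hn₂, ← mul_assoc, star_sub, star_mul, sub_mul, mul_assoc, a1, hn₁, star_mul, hBs,
      mul_assoc, a2]
    simp
  have hn₂P : star n₂ * (W * c - n₁) = 0 := by simpa using congrArg star hPn₂
  have hsum : ∀ u v : A, star u * v = 0 → star v * u = 0 → ‖u - v‖ ^ 2 ≤ ‖u‖ ^ 2 + ‖v‖ ^ 2 := by
    intro u v huv hvu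
    rw [sq, ← CStarRing.norm_star_mul_self]
    have : star (u - v) * (u - v) = star u * u + star v * v := by
      rw [star_sub, sub_mul, mul_sub, mul_sub, huv, hvu]; abel
    rw [this]
    refine (norm_add_le _ _).trans ?_
    rw [CStarRing.norm_star_mul_self, CStarRing.norm_star_mul_self]
    exact le_of_eq (by ring)
  have hY : ‖W * c - n₁ - n₂‖ ^ 2 ≤ (1 - α.re) ^ 2 + 3 * ρ ^ 2 := by
    have s1 := hsum _ _ hPn₂ hn₂P
    have s2 : ‖W * c - n₁‖ ^ 2 ≤ ‖W * c‖ ^ 2 + ‖n₁‖ ^ 2 := by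
      have := hsum (star (W * c)) (star n₁) (by rw [star_star]; exact hcn₁)
        (by rw [star_star]; exact hn₁c)
      rwa [← star_sub, norm_star, norm_star, norm_star] at this
    have s3 : ‖W * c‖ ≤ ‖c‖ := norm_mul_le_of_left hW le_rfl
    have s4 := norm_sq_sub_smul_le hb.nonneg hb.norm_le (hα.trans hρ)
    have s5 : ‖W * c‖ ^ 2 ≤ ‖c‖ ^ 2 := by gcongr
    have s6 : ‖n₁‖ ^ 2 ≤ ρ ^ 2 := by gcongr
    have s7 : ‖n₂‖ ^ 2 ≤ ρ ^ 2 := by gcongr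
    have s8 : ‖α‖ ^ 2 ≤ ρ ^ 2 := by gcongr
    linarith
  have hre : α.re ≤ 1 / 2 := (Complex.re_le_norm α).trans (hα.trans hρ)
  have hYle : ‖W * c - n₁ - n₂‖ ≤ 1 - α.re + 3 * ρ ^ 2 := by
    refine le_of_sq_le_sq (hY.trans ?_) (by nlinarith)
    nlinarith [sq_nonneg ρ, sq_nonneg (ρ ^ 2), mul_nonneg (sub_nonneg.2 hre) (sq_nonneg ρ)]
  rw [hdec]
  refine (norm_add_le _ _).trans ?_
  rw [norm_neg]
  linarith

end Sandwich

section FaceContext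

variable {A : Type*} [CStarAlgebra A] [PartialOrder A] [StarOrderedRing A]
  {Y : Type*} [NormedAddCommGroup Y] [NormedSpace ℝ Y]

/-- Functionals supporting both `T x` and `-T (-x)` for every contraction `x` that agrees with `W`
on the region `b`. -/
def IsSupport (T : A → Y) (W b : A) (f : Y →L[ℝ] ℝ) : Prop :=
  (∀ y, |f y| ≤ ‖y‖) ∧ ∀ x, ‖x‖ ≤ 1 → x * b = W * b → f (T x) = 1 ∧ f (T (-x)) = -1

/-- A subset `E` of the unit sphere whose image under `T` is convex and which is stable under
those contractive perturbations that factor through `W`. -/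
structure IsFaceContext (T : A → Y) (E : Set A) (W : A) : Prop where
  iso : IsSphereIsometry T
  norm_le : ‖W‖ ≤ 1
  norm_eq_one : ∀ z ∈ E, ‖z‖ = 1
  perturb_mem : ∀ z ∈ E, ∀ u v, ‖z + W * u + v * (star W * W)‖ ≤ 1 →
    z + W * u + v * (star W * W) ∈ E
  exists_combo : ∀ y ∈ E, ∀ z ∈ E, ∀ μ : ℝ, 0 ≤ μ → μ ≤ 1 →
    ∃ w ∈ E, T w = (1 - μ) • T y + μ • T z

variable {T : A → Y} {E : Set A} {W e b : A}

theorem IsRegion.norm_eq_one_of_mul_eq (hb : IsRegion (star W * W) b) {x : A} (hx : ‖x‖ ≤ 1)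
    (h : x * b = W * b) : ‖x‖ = 1 := by
  obtain ⟨c, hc, hbc⟩ := hb.plateau
  have hxc : x * c = W * c := by rw [← hbc, ← mul_assoc, h, mul_assoc]
  have hDc : star W * (W * c) = c := by rw [← hbc, hb.unit_left_assoc]
  have hWc : ‖W * c‖ * ‖W * c‖ = ‖c‖ * ‖c‖ := by
    rw [← CStarRing.norm_star_mul_self, ← CStarRing.norm_star_mul_self, star_mul, mul_assoc, hDc]
  have h1 := norm_mul_le x c
  rw [hxc] at h1
  have hc0 : 0 < ‖c‖ := norm_pos_iff.2 hc
  have h2 : ‖W * c‖ = ‖c‖ := by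
    rw [← abs_of_nonneg (norm_nonneg (W * c)), ← abs_of_nonneg (norm_nonneg c)]
    exact (abs_eq_abs.2 (mul_self_eq_mul_self_iff.1 hWc))
  refine le_antisymm hx ?_
  rw [h2] at h1
  nlinarith

theorem IsSphereIsometry.exists_isSupport (hT : IsSphereIsometry T)
    (hb : IsRegion (star W * W) b) : ∃ f, IsSupport T W b f := by
  obtain ⟨f, hf, hf'⟩ := hT.exists_support (C := {x : A | ‖x‖ ≤ 1 ∧ x * b = W * b}) (by
      rintro x ⟨hx, hx'⟩ y ⟨hy, hy'⟩ s t hs ht hst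
      refine ⟨?_, ?_⟩
      · exact mem_closedBall_zero_iff.1 (convex_closedBall (0 : A) 1
          (mem_closedBall_zero_iff.2 hx) (mem_closedBall_zero_iff.2 hy) hs ht hst)
      · rw [add_mul, smul_mul_assoc, smul_mul_assoc, hx', hy', ← add_smul, hst, one_smul])
    fun x hx => hb.norm_eq_one_of_mul_eq hx.1 hx.2
  exact ⟨f, hf, fun x hx hx' => hf' x ⟨hx, hx'⟩⟩

theorem IsSupport.mono {f : Y →L[ℝ] ℝ} (hf : IsSupport T W b f) (heb : e * b = b) :
    IsSupport T W e f :=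
  ⟨hf.1, fun x hx hx' => hf.2 x hx (by rw [← heb, ← mul_assoc, hx', mul_assoc])⟩

/-- On a set of vectors with small row and column along the region, every support functional
reads off the compression to the region up to a quadratic error. -/
theorem IsSphereIsometry.abs_support_sub_le (hT : IsSphereIsometry T) (hW : ‖W‖ ≤ 1)
    (he : IsRegion (star W * W) e) {b' z : A}
    (hb : IsRegion (star W * W) b) (hb' : IsRegion (star W * W) b') (heb : e * b = b)
    (hbb' : b * b' = b') (hz : ‖z‖ = 1) {α : ℂ} {θ ρ : ℝ}
    (hθ : ‖e * (star W * z) * e - α • (e * e)‖ ≤ θ) (hrow : ‖b * (star W * z)‖ ≤ ρ)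
    (hcol : ‖z * b‖ ≤ ρ) (hα : ‖α‖ ≤ ρ) (hρ : ρ ≤ 1 / 2) {f : Y →L[ℝ] ℝ}
    (hf : IsSupport T W b' f) : |f (T z) - α.re| ≤ 3 * ρ ^ 2 + 4 * θ := by
  obtain ⟨x, hx, hx', hzx⟩ := exists_contraction_near hW he hb heb hbb' hz.le hθ hrow hcol hα hρ
  have hD : star (-W) * (-W) = star W * W := by simp
  have eneg : e * (star (-W) * z) * e - (-α) • (e * e) =
      -(e * (star W * z) * e - α • (e * e)) := by
    simp only [star_neg, neg_mul, mul_neg, neg_smul]; abel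
  obtain ⟨x₂, hx₂, hx₂', hzx₂⟩ := exists_contraction_near (W := -W) (e := e) (b := b) (b' := b')
    (z := z) (α := -α) (θ := θ) (ρ := ρ) (by simpa using hW) (by rwa [hD]) (by rwa [hD])
    heb hbb' hz.le (by rw [eneg, norm_neg]; exact hθ)
    (by simpa using hrow) hcol (by simpa using hα) hρ
  have n1 : ‖x‖ = 1 := hb'.norm_eq_one_of_mul_eq hx hx'
  have hx₃ : -x₂ * b' = W * b' := by rw [neg_mul, hx₂', neg_mul, neg_neg]
  have n2 : ‖-x₂‖ = 1 := hb'.norm_eq_one_of_mul_eq (by simpa using hx₂) hx₃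
  rw [norm_neg] at n2
  have f1 := (hf.2 x hx hx').1
  have f2 := (hf.2 (-x₂) (by simpa using hx₂) hx₃).2
  rw [neg_neg] at f2
  have g1 := (abs_le.1 (hf.1 (T z - T x))).1
  have g2 := (abs_le.1 (hf.1 (T z - T x₂))).2
  rw [map_sub, hT.norm_sub _ _ hz n1, f1] at g1
  rw [map_sub, hT.norm_sub _ _ hz n2, f2] at g2
  rw [Complex.neg_re] at hzx₂
  rw [abs_le]
  constructor <;> linarith

/-- Affine combinations in the image are, in the domain, within a controlled distance of the
corresponding combinations. -/
theorem IsSphereIsometry.defect_le (hT : IsSphereIsometry T) {y z w : A} (hy : ‖y‖ = 1)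
    (hz : ‖z‖ = 1) (hw : ‖w‖ = 1) {μ : ℝ} (h0 : 0 ≤ μ) (h1 : μ ≤ 1)
    (hTw : T w = (1 - μ) • T y + μ • T z) {r : ℝ} (hr : ‖z - y‖ ≤ r) :
    ‖w - y‖ = μ * ‖z - y‖ ∧
    star (w - y - μ • (z - y)) * (w - y - μ • (z - y)) ≤
      (r ^ 2) • (1 : A) - star (z - y) * (z - y) ∧
    (w - y - μ • (z - y)) * star (w - y - μ • (z - y)) ≤
      (r ^ 2) • (1 : A) - (z - y) * star (z - y) := by
  have hr0 : 0 ≤ r := (norm_nonneg _).trans hr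
  have e1 : ‖w - y‖ = μ * ‖z - y‖ := by
    rw [← hT.norm_sub _ _ hw hy, ← hT.norm_sub _ _ hz hy, hTw,
      show (1 - μ) • T y + μ • T z - T y = μ • (T z - T y) by module, norm_smul,
      Real.norm_of_nonneg h0]
  have e2 : ‖z - w‖ = (1 - μ) * ‖z - y‖ := by
    rw [← hT.norm_sub _ _ hz hw, ← hT.norm_sub _ _ hz hy, hTw,
      show T z - ((1 - μ) • T y + μ • T z) = (1 - μ) • (T z - T y) by module, norm_smul,
      Real.norm_of_nonneg (by linarith)]
  have hμ : 0 ≤ 1 - μ := by linarith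
  have hμμ : 0 ≤ μ * (1 - μ) := mul_nonneg h0 hμ
  have hμ1 : μ * (1 - μ) ≤ 1 := by nlinarith
  have key : ∀ p v : A, ‖p‖ ≤ μ * r → ‖v - p‖ ≤ (1 - μ) * r → ‖v‖ ≤ r →
      star (p - μ • v) * (p - μ • v) ≤ (r ^ 2) • (1 : A) - star v * v := by
    intro p v hp hs hv
    have i1 := star_mul_self_le_sq_smul_one hp
    have i2 := star_mul_self_le_sq_smul_one hs
    have i3 : 0 ≤ (r ^ 2) • (1 : A) - star v * v :=
      sub_nonneg.2 (star_mul_self_le_sq_smul_one hv)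
    have i4 := add_le_add (smul_le_smul_of_nonneg_left i1 hμ) (smul_le_smul_of_nonneg_left i2 h0)
    have i5 : star (p - μ • v) * (p - μ • v) + (μ * (1 - μ)) • (star v * v) =
        (1 - μ) • (star p * p) + μ • (star (v - p) * (v - p)) := by
      simp only [star_sub, star_smul, star_trivial, mul_sub, sub_mul, smul_mul_assoc,
        mul_smul_comm]
      module
    rw [← i5] at i4
    have i6 : star (p - μ • v) * (p - μ • v) ≤ (μ * (1 - μ)) • ((r ^ 2) • (1 : A) - star v * v) := by
      rw [smul_sub, le_sub_iff_add_le]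
      refine i4.trans (le_of_eq ?_)
      module
    refine i6.trans ?_
    have i7 := smul_nonneg (sub_nonneg.2 hμ1) i3
    rw [sub_smul, one_smul, sub_nonneg] at i7
    exact i7
  have hs1 : ‖w - y‖ ≤ μ * r := by rw [e1]; gcongr
  have hs2 : ‖(z - y) - (w - y)‖ ≤ (1 - μ) * r := by
    rw [sub_sub_sub_cancel_right, e2]; gcongr
  refine ⟨e1, key _ _ hs1 hs2 hr, ?_⟩
  have := key (star (w - y)) (star (z - y)) (by rwa [norm_star])
    (by rwa [← star_sub, norm_star]) (by rwa [norm_star])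
  have e : star (w - y) - μ • star (z - y) = star (w - y - μ • (z - y)) := by
    rw [star_sub (w - y) (μ • (z - y)), star_smul μ (z - y), star_trivial μ]
  rwa [e, star_star, star_star] at this

theorem norm_sq_mul_right_le {Δ P b : A} (hb : star b = b) (h : star Δ * Δ ≤ P) :
    ‖Δ * b‖ ^ 2 ≤ ‖b * P * b‖ := by
  refine norm_sq_le_of_star_mul_self_le ?_
  have := star_left_conjugate_le_conjugate h b
  rw [hb] at this
  rw [star_mul, hb]
  convert this using 1
  noncomm_ring

theorem norm_sq_mul_left_le {Δ P V : A} (h : Δ * star Δ ≤ P) :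
    ‖V * Δ‖ ^ 2 ≤ ‖V * P * star V‖ := by
  refine norm_sq_le_of_mul_star_self_le ?_
  have := star_right_conjugate_le_conjugate h V
  rw [star_mul]
  convert this using 1
  noncomm_ring

theorem norm_smul_mul_self_le (hb : IsRegion (star W * W) b) {r : ℝ} (hr : 0 ≤ r) :
    ‖(r : ℂ) • (b * b)‖ ≤ r := by
  rw [norm_smul, hb.norm_mul_self, mul_one, Complex.norm_real, Real.norm_of_nonneg hr]

namespace IsFaceContext

theorem column_step (ctx : IsFaceContext T E W) {z : A} (hz : z ∈ E)
    (he : IsRegion (star W * W) e) {μ θ : ℝ} (h0 : 0 ≤ μ) (h1 : μ ≤ 1) (hθ : 0 < θ) :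
    ∃ b y w p : A, IsRegion (star W * W) b ∧ e * b = b ∧ y ∈ E ∧ w ∈ E ∧
      T w = (1 - μ) • T y + μ • T z ∧ y = z * p ∧ ‖p‖ ≤ 1 ∧ y * b = 0 ∧ ‖w - y‖ ≤ μ ∧
      ‖w * b - μ • (z * b)‖ ≤ θ := by
  have hη : 0 < θ ^ 2 / 2 := by positivity
  have nz := ctx.norm_eq_one z hz
  obtain ⟨e₁, s, hs, he₁, hee₁, hex⟩ := he.excision_nonneg (star_mul_self_nonneg z) hη
  obtain ⟨b₁, hb₁, hb₁e⟩ := he₁.exists_sub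
  obtain ⟨b, hb, hbb₁⟩ := hb₁.exists_sub
  have hp : ‖1 - b₁‖ ≤ 1 := norm_one_sub_le hb₁.nonneg hb₁.norm_le
  have hyE : z * (1 - b₁) ∈ E := by
    have e1 : z * (1 - b₁) = z + W * 0 + (-(z * b₁)) * (star W * W) := by
      rw [neg_mul, mul_assoc z, hb₁.unit_right]; noncomm_ring
    rw [e1]
    refine ctx.perturb_mem z hz 0 _ ?_
    rw [← e1]
    exact norm_mul_le_of_right nz.le hp
  obtain ⟨w, hw, hTw⟩ := ctx.exists_combo _ hyE z hz μ h0 h1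
  have hv : z - z * (1 - b₁) = z * b₁ := by noncomm_ring
  have hexb₁ := (hb₁.norm_compress_le he₁ hb₁e (star z * z) s).trans hex
  have hexb := (hb.norm_compress_le hb₁ hbb₁ (star z * z) s).trans hexb₁
  have hvn : ‖z - z * (1 - b₁)‖ ≤ √(s + θ ^ 2 / 2) := by
    rw [hv]
    refine Real.le_sqrt_of_sq_le ?_
    have e2 : star (z * b₁) * (z * b₁) = b₁ * (star z * z) * b₁ := by
      rw [star_mul, hb₁.star_eq]; noncomm_ring
    rw [sq, ← CStarRing.norm_star_mul_self, e2]
    have := norm_sub_norm_le (b₁ * (star z * z) * b₁) ((s : ℂ) • (b₁ * b₁))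
    linarith [norm_smul_mul_self_le hb₁ hs]
  obtain ⟨d1, d2, -⟩ := ctx.iso.defect_le (ctx.norm_eq_one _ hyE) nz (ctx.norm_eq_one _ hw) h0 h1
    hTw hvn
  rw [Real.sq_sqrt (by positivity), hv] at d2
  have hyb : z * (1 - b₁) * b = 0 := by
    rw [mul_assoc, sub_mul, one_mul, hbb₁, sub_self, mul_zero]
  refine ⟨b, z * (1 - b₁), w, 1 - b₁, hb, IsRegion.sub_trans hee₁ (IsRegion.sub_trans hb₁e hbb₁),
    hyE, hw, hTw, rfl, hp, hyb, ?_, ?_⟩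
  · rw [d1, hv]
    exact mul_le_of_le_one_right h0 (norm_mul_le_of_right nz.le hb₁.norm_le)
  · have e3 : w * b - μ • (z * b) = (w - z * (1 - b₁) - μ • (z * b₁)) * b := by
      rw [sub_mul, sub_mul, hyb, smul_mul_assoc, mul_assoc z b₁, hbb₁, sub_zero]
    rw [e3]
    refine le_of_sq_le_sq ((norm_sq_mul_right_le hb.star_eq d2).trans ?_) hθ.le
    have hbb₁' := hb.mul_right_unit hb₁ hbb₁
    have e4 : b * ((s + θ ^ 2 / 2) • (1 : A) - star (z * b₁) * (z * b₁)) * b =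
        (((θ ^ 2 / 2 : ℝ) : ℂ) • (b * b)) - (b * (star z * z) * b - (s : ℂ) • (b * b)) := by
      rw [Complex.coe_smul, Complex.coe_smul]
      simp only [star_mul, hb₁.star_eq, mul_sub, sub_mul, mul_smul_comm, smul_mul_assoc, mul_one,
        mul_assoc, hbb₁, mul_mul_of_mul_eq hbb₁']
      module
    rw [e4]
    refine (norm_sub_le _ _).trans ?_
    linarith [norm_smul_mul_self_le hb hη.le]

theorem row_step (ctx : IsFaceContext T E W) {z : A} (hz : z ∈ E)
    (he : IsRegion (star W * W) e) {μ θ : ℝ} (h0 : 0 ≤ μ) (h1 : μ ≤ 1) (hθ : 0 < θ) :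
    ∃ b y w p : A, IsRegion (star W * W) b ∧ e * b = b ∧ y ∈ E ∧ w ∈ E ∧
      T w = (1 - μ) • T y + μ • T z ∧ y = p * z ∧ ‖p‖ ≤ 1 ∧ b * (star W * y) = 0 ∧ ‖w - y‖ ≤ μ ∧
      ‖b * (star W * w) - μ • (b * (star W * z))‖ ≤ θ := by
  have hη : 0 < θ ^ 2 / 2 := by positivity
  have nz := ctx.norm_eq_one z hz
  have hW := ctx.norm_le
  obtain ⟨e₁, s, hs, he₁, hee₁, hex⟩ := he.excision_nonneg (star_mul_self_nonneg (star z * W)) hη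
  obtain ⟨b₁, hb₁, hb₁e⟩ := he₁.exists_sub
  obtain ⟨b, hb, hbb₁⟩ := hb₁.exists_sub
  have hp : ‖1 - W * b₁ * star W‖ ≤ 1 := norm_one_sub_le hb₁.conj_nonneg (hb₁.norm_conj_le hW)
  have hyE : (1 - W * b₁ * star W) * z ∈ E := by
    have e1 : (1 - W * b₁ * star W) * z = z + W * (-(b₁ * star W * z)) + 0 * (star W * W) := by
      noncomm_ring
    rw [e1]
    refine ctx.perturb_mem z hz _ 0 ?_
    rw [← e1]
    exact norm_mul_le_of_left hp nz.le
  obtain ⟨w, hw, hTw⟩ := ctx.exists_combo _ hyE z hz μ h0 h1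
  have hv : z - (1 - W * b₁ * star W) * z = W * (b₁ * (star W * z)) := by noncomm_ring
  have hexb₁ := (hb₁.norm_compress_le he₁ hb₁e (star (star z * W) * (star z * W)) s).trans hex
  have hexb := (hb.norm_compress_le hb₁ hbb₁ (star (star z * W) * (star z * W)) s).trans hexb₁
  have hvn' : ‖b₁ * (star W * z)‖ ≤ √(s + θ ^ 2 / 2) := by
    refine Real.le_sqrt_of_sq_le ?_
    have e2 : b₁ * (star W * z) * star (b₁ * (star W * z)) =
        b₁ * (star (star z * W) * (star z * W)) * b₁ := by
      simp only [star_mul, hb₁.star_eq, star_star]; noncomm_ring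
    rw [sq, ← CStarRing.norm_self_mul_star, e2]
    have := norm_sub_norm_le (b₁ * (star (star z * W) * (star z * W)) * b₁) ((s : ℂ) • (b₁ * b₁))
    linarith [norm_smul_mul_self_le hb₁ hs]
  have hvn : ‖z - (1 - W * b₁ * star W) * z‖ ≤ √(s + θ ^ 2 / 2) := by
    rw [hv]
    exact norm_mul_le_of_left hW hvn'
  obtain ⟨d1, -, d2⟩ := ctx.iso.defect_le (ctx.norm_eq_one _ hyE) nz (ctx.norm_eq_one _ hw) h0 h1
    hTw hvn
  have hbb₁' := hb.mul_right_unit hb₁ hbb₁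
  rw [Real.sq_sqrt (by positivity), hv] at d2
  have hyb : b * (star W * ((1 - W * b₁ * star W) * z)) = 0 := by
    simp only [mul_sub, sub_mul, one_mul, mul_assoc, hb.unit_right_assoc,
      mul_mul_of_mul_eq hbb₁', sub_self]
  refine ⟨b, (1 - W * b₁ * star W) * z, w, 1 - W * b₁ * star W, hb,
    IsRegion.sub_trans hee₁ (IsRegion.sub_trans hb₁e hbb₁), hyE, hw, hTw, rfl, hp, hyb, ?_, ?_⟩
  · rw [d1, hv]
    refine mul_le_of_le_one_right h0 (norm_mul_le_of_left hW (norm_mul_le_of_left hb₁.norm_le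
      (norm_mul_le_of_left ?_ nz.le)))
    rwa [norm_star]
  · have e3 : b * (star W * w) - μ • (b * (star W * z)) =
        (b * star W) * (w - (1 - W * b₁ * star W) * z - μ • (W * (b₁ * (star W * z)))) := by
      rw [mul_sub, mul_sub, mul_assoc b, mul_assoc b, hyb, mul_smul_comm, sub_zero]
      simp only [mul_assoc, hb.unit_right_assoc, mul_mul_of_mul_eq hbb₁']
    rw [e3]
    refine le_of_sq_le_sq ((norm_sq_mul_left_le d2).trans ?_) hθ.le
    have e4 : b * star W * ((s + θ ^ 2 / 2) • (1 : A) - W * (b₁ * (star W * z)) *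
        star (W * (b₁ * (star W * z)))) * star (b * star W) =
        (((θ ^ 2 / 2 : ℝ) : ℂ) • (b * b)) -
          (b * (star (star z * W) * (star z * W)) * b - (s : ℂ) • (b * b)) := by
      rw [Complex.coe_smul, Complex.coe_smul]
      simp only [star_mul, hb₁.star_eq, hb.star_eq, star_star, mul_sub, sub_mul, mul_smul_comm,
        smul_mul_assoc, mul_one, mul_assoc, hb.unit_right_assoc, mul_mul_of_mul_eq hbb₁',
        hb.unit_left, hbb₁]
      module
    rw [e4]
    refine (norm_sub_le _ _).trans ?_
    linarith [norm_smul_mul_self_le hb hη.le]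

end IsFaceContext

end FaceContext

section Vanishing

variable {A : Type*} [CStarAlgebra A] [PartialOrder A] [StarOrderedRing A]
  {Y : Type*} [NormedAddCommGroup Y] [NormedSpace ℝ Y] {T : A → Y} {E : Set A} {W e : A}

theorem norm_le_of_norm_sub_smul_le {a b : A} {μ θ r : ℝ} (hμ : 0 ≤ μ) (h : ‖a - μ • b‖ ≤ θ)
    (hb : ‖b‖ ≤ r) : ‖a‖ ≤ μ * r + θ := by
  have := norm_sub_norm_le a (μ • b)
  rw [norm_smul, Real.norm_of_nonneg hμ] at this
  have := mul_le_mul_of_nonneg_left hb hμ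
  linarith

/-- Reading off a functional at an endpoint of a segment from its values at the other endpoint and
at an interior point. -/
theorem abs_map_sub_le_of_combo {f : Y →L[ℝ] ℝ} {y z w : Y} {μ : ℝ} (h0 : 0 < μ) (h1 : μ ≤ 1)
    (hw : w = (1 - μ) • y + μ • z) {c c₀ ε δ : ℝ} (hy : |f y - c₀| ≤ δ)
    (hfw : |f w - ((1 - μ) * c₀ + μ * c)| ≤ ε) : |f z - c| ≤ (ε + δ) / μ := by
  rw [le_div_iff₀ h0]
  have e : (f z - c) * μ = (f w - ((1 - μ) * c₀ + μ * c)) - (1 - μ) * (f y - c₀) := by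
    rw [hw, map_add, map_smul, map_smul, smul_eq_mul, smul_eq_mul]; ring
  calc |f z - c| * μ = |(f z - c) * μ| := by rw [abs_mul, abs_of_pos h0]
    _ ≤ |f w - ((1 - μ) * c₀ + μ * c)| + |(1 - μ) * (f y - c₀)| := by rw [e]; exact abs_sub _ _
    _ ≤ ε + δ := by
      rw [abs_mul, abs_of_nonneg (by linarith : 0 ≤ 1 - μ)]
      have := mul_le_mul_of_nonneg_right (by linarith : 1 - μ ≤ 1) (abs_nonneg (f y - c₀))
      linarith

namespace IsFaceContext

theorem exists_abs_support_le_of_row_eq_zero (ctx : IsFaceContext T E W) {z : A} (hz : z ∈ E)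
    (he : IsRegion (star W * W) e) (h : e * (star W * z) = 0) {δ : ℝ} (hδ : 0 < δ) :
    ∃ b, IsRegion (star W * W) b ∧ e * b = b ∧ ∀ f, IsSupport T W b f → |f (T z)| ≤ δ := by
  have hμ : 0 < min (1 / 4) (δ / 16) := by positivity
  have hμ4 : min (1 / 4) (δ / 16) ≤ 1 / 4 := min_le_left _ _
  have hμδ : min (1 / 4) (δ / 16) ≤ δ / 16 := min_le_right _ _
  set μ := min (1 / 4) (δ / 16)
  obtain ⟨b₁, y, w, p, hb₁, heb₁, hyE, hwE, hTw, hyp, -, hyb, hwy, hwb⟩ :=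
    ctx.column_step hz he hμ.le (by linarith : μ ≤ 1) (θ := μ ^ 2) (by positivity)
  obtain ⟨b₂, hb₂, h12⟩ := hb₁.exists_sub
  obtain ⟨b₃, hb₃, h23⟩ := hb₂.exists_sub
  have hb₁e := hb₁.mul_right_unit he heb₁
  have hb₂₁ := hb₂.mul_right_unit hb₁ h12
  have hz0 : b₁ * (star W * z) = 0 := by rw [← hb₁e, mul_assoc, h, mul_zero]
  have hy0 : b₁ * (star W * y) = 0 := by
    rw [hyp, ← mul_assoc (star W), ← mul_assoc, hz0, zero_mul]
  have hy0' : b₂ * (star W * y) = 0 := by rw [← hb₂₁, mul_assoc, hy0, mul_zero]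
  have hyb' : y * b₂ = 0 := by rw [← h12, ← mul_assoc, hyb, zero_mul]
  refine ⟨b₃, hb₃, IsRegion.sub_trans heb₁ (IsRegion.sub_trans h12 h23), fun f hf => ?_⟩
  have hfy : |f (T y)| ≤ 0 := by
    have := ctx.iso.abs_support_sub_le ctx.norm_le hb₁ hb₂ hb₃ h12 h23 (ctx.norm_eq_one y hyE)
      (α := 0) (θ := 0) (ρ := 0) (by rw [hy0]; simp) (by rw [hy0']; simp) (by rw [hyb']; simp)
      (by simp) (by norm_num) hf
    simpa using this
  have hw11 : ‖b₁ * (star W * w) * b₁ - (0 : ℂ) • (b₁ * b₁)‖ ≤ μ ^ 2 := by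
    have : b₁ * (star W * w) * b₁ - (0 : ℂ) • (b₁ * b₁) =
        b₁ * (star W * (w * b₁ - μ • (z * b₁))) := by
      rw [zero_smul, sub_zero, mul_sub, mul_sub, mul_smul_comm, mul_smul_comm, ← mul_assoc _ z,
        ← mul_assoc b₁ (star W * z), hz0, zero_mul, smul_zero, sub_zero, mul_assoc, mul_assoc]
    rw [this]
    exact norm_mul_le_of_left hb₁.norm_le (norm_mul_le_of_left (by simpa using ctx.norm_le) hwb)
  have hcol : ‖w * b₂‖ ≤ 2 * μ := by
    rw [← h12, ← mul_assoc]
    refine norm_mul_le_of_right ?_ hb₂.norm_le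
    have := norm_le_of_norm_sub_smul_le hμ.le hwb
      (norm_mul_le_of_left (ctx.norm_eq_one z hz).le hb₁.norm_le)
    nlinarith
  have hrow : ‖b₂ * (star W * w)‖ ≤ 2 * μ := by
    have : b₂ * (star W * w) = b₂ * (star W * (w - y)) := by
      rw [mul_sub, mul_sub, hy0', sub_zero]
    rw [this]
    have := norm_mul_le_of_left hb₂.norm_le
      (norm_mul_le_of_left (by simpa using ctx.norm_le : ‖star W‖ ≤ 1) hwy)
    linarith
  have hfw := ctx.iso.abs_support_sub_le ctx.norm_le hb₁ hb₂ hb₃ h12 h23 (ctx.norm_eq_one w hwE)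
    hw11 hrow hcol (by simp; linarith) (by linarith) hf
  have := abs_map_sub_le_of_combo (f := f) hμ (by linarith) hTw (c := 0) (c₀ := 0)
    (δ := 0) (by simpa using hfy) (by simpa using hfw)
  rw [sub_zero] at this
  refine this.trans ?_
  rw [div_le_iff₀ hμ]
  nlinarith

theorem exists_abs_support_le_of_column_eq_zero (ctx : IsFaceContext T E W) {z : A} (hz : z ∈ E)
    (he : IsRegion (star W * W) e) (h : z * e = 0) {δ : ℝ} (hδ : 0 < δ) :
    ∃ b, IsRegion (star W * W) b ∧ e * b = b ∧ ∀ f, IsSupport T W b f → |f (T z)| ≤ δ := by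
  have hμ : 0 < min (1 / 4) (δ / 16) := by positivity
  have hμ4 : min (1 / 4) (δ / 16) ≤ 1 / 4 := min_le_left _ _
  have hμδ : min (1 / 4) (δ / 16) ≤ δ / 16 := min_le_right _ _
  set μ := min (1 / 4) (δ / 16)
  obtain ⟨b₁, y, w, p, hb₁, heb₁, hyE, hwE, hTw, hyp, -, hyb, hwy, hwb⟩ :=
    ctx.row_step hz he hμ.le (by linarith : μ ≤ 1) (θ := μ ^ 2) (by positivity)
  obtain ⟨b₂, hb₂, h12⟩ := hb₁.exists_sub
  obtain ⟨b₃, hb₃, h23⟩ := hb₂.exists_sub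
  have hb₂₁ := hb₂.mul_right_unit hb₁ h12
  have hz0 : z * b₁ = 0 := by rw [← heb₁, ← mul_assoc, h, zero_mul]
  have hy0 : y * b₁ = 0 := by rw [hyp, mul_assoc, hz0, mul_zero]
  have hy0' : y * b₂ = 0 := by rw [← h12, ← mul_assoc, hy0, zero_mul]
  have hyb' : b₂ * (star W * y) = 0 := by rw [← hb₂₁, mul_assoc, hyb, mul_zero]
  refine ⟨b₃, hb₃, IsRegion.sub_trans heb₁ (IsRegion.sub_trans h12 h23), fun f hf => ?_⟩
  have hfy : |f (T y)| ≤ 0 := by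
    have := ctx.iso.abs_support_sub_le ctx.norm_le hb₁ hb₂ hb₃ h12 h23 (ctx.norm_eq_one y hyE)
      (α := 0) (θ := 0) (ρ := 0) (by rw [hyb]; simp) (by rw [hyb']; simp) (by rw [hy0']; simp)
      (by simp) (by norm_num) hf
    simpa using this
  have hw11 : ‖b₁ * (star W * w) * b₁ - (0 : ℂ) • (b₁ * b₁)‖ ≤ μ ^ 2 := by
    have : b₁ * (star W * w) * b₁ - (0 : ℂ) • (b₁ * b₁) =
        (b₁ * (star W * w) - μ • (b₁ * (star W * z))) * b₁ := by
      rw [zero_smul, sub_zero, sub_mul, smul_mul_assoc, mul_assoc b₁ (star W * z),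
        mul_assoc (star W) z, hz0, mul_zero, mul_zero, smul_zero, sub_zero]
    rw [this]
    exact norm_mul_le_of_right hwb hb₁.norm_le
  have hWs : ‖star W‖ ≤ 1 := by simpa using ctx.norm_le
  have hrow : ‖b₂ * (star W * w)‖ ≤ 2 * μ := by
    rw [← hb₂₁, mul_assoc]
    refine norm_mul_le_of_left hb₂.norm_le ?_
    have := norm_le_of_norm_sub_smul_le hμ.le hwb (norm_mul_le_of_left hb₁.norm_le
      (norm_mul_le_of_left hWs (ctx.norm_eq_one z hz).le))
    nlinarith
  have hcol : ‖w * b₂‖ ≤ 2 * μ := by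
    have : w * b₂ = (w - y) * b₂ := by rw [sub_mul, hy0', sub_zero]
    rw [this]
    have := norm_mul_le_of_right hwy hb₂.norm_le
    linarith
  have hfw := ctx.iso.abs_support_sub_le ctx.norm_le hb₁ hb₂ hb₃ h12 h23 (ctx.norm_eq_one w hwE)
    hw11 hrow hcol (by simp; linarith) (by linarith) hf
  have := abs_map_sub_le_of_combo (f := f) hμ (by linarith) hTw (c := 0) (c₀ := 0)
    (δ := 0) (by simpa using hfy) (by simpa using hfw)
  rw [sub_zero] at this
  refine this.trans ?_
  rw [div_le_iff₀ hμ]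
  nlinarith

end IsFaceContext

end Vanishing

section Rotation

variable {A : Type*} [CStarAlgebra A] [PartialOrder A] [StarOrderedRing A] {W e b b' k z : A}

/-- The element `1 + k` is unitary, equals `1` away from `e`, and equals `-1` on `b`. -/
structure IsRotation (e b k : A) : Prop where
  mul_star_self : k * star k = -(k + star k)
  star_mul_self : star k * k = -(k + star k)
  left_unit : e * k = k
  right_unit : k * e = k
  mul_eq : k * b = -(b + b)
  eq_mul : b * k = -(b + b)
  norm_le : ‖k‖ ≤ 2

theorem IsRegion.exists_isRotation (he : IsRegion (star W * W) e) (hb : IsRegion (star W * W) b)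
    (hb' : IsRegion (star W * W) b') (heb : e * b = b) (hbb' : b * b' = b') :
    ∃ k, IsRotation e b' k := by
  have hbe := hb.mul_right_unit he heb
  have hb'b := hb'.mul_right_unit hb hbb'
  have heb' : e * b' = b' := IsRegion.sub_trans heb hbb'
  have hsa : IsSelfAdjoint b := hb.star_eq
  set s : A := cfc (fun t : ℝ => 2 * √(t - t ^ 2)) b with hs
  have hss : star s = s := (cfc_predicate (fun t : ℝ => 2 * √(t - t ^ 2)) b :)
  have hcomm : b * s = s * b := by
    have := (cfc_commute_cfc (fun t : ℝ => t) (fun t : ℝ => 2 * √(t - t ^ 2)) b).eq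
    rwa [cfc_id' ℝ b] at this
  have hsq : s * s = (4 : ℂ) • (b - b * b) := by
    have h4 : (4 : ℂ) • (b - b * b) = (4 : ℝ) • (b - b * b) := by
      rw [← Complex.coe_smul]; norm_num
    have e1 : (4 : ℝ) • (b - b * b) = cfc (fun t : ℝ => 4 * (t - t * t)) b := by
      rw [cfc_const_mul _ _ b (by fun_prop), cfc_sub _ _ b (by fun_prop) (by fun_prop),
        cfc_mul _ _ b (by fun_prop) (by fun_prop), cfc_id' ℝ b]
    rw [h4, e1, hs, ← cfc_mul _ _ b (by fun_prop) (by fun_prop)]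
    refine cfc_congr fun t ht => ?_
    have t0 : 0 ≤ t := spectrum_nonneg_of_nonneg hb.nonneg ht
    have t1 : t ≤ 1 := by
      rcases subsingleton_or_nontrivial A with _ | _
      · simp [spectrum.of_subsingleton] at ht
      exact (le_abs_self t).trans ((spectrum.norm_le_norm_of_mem ht).trans hb.norm_le)
    have := Real.mul_self_sqrt (show 0 ≤ t - t ^ 2 by nlinarith)
    linear_combination 4 * this
  have hz : ∀ c : A, b * c = b * (b * c) → s * c = 0 := by
    intro c hc
    rw [← CStarRing.star_mul_self_eq_zero_iff, star_mul, hss, mul_assoc, ← mul_assoc s, hsq,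
      smul_mul_assoc, sub_mul, mul_assoc b, ← hc, sub_self, smul_zero, mul_zero]
  have hsb' : s * b' = 0 := hz b' (by rw [hbb', hbb'])
  have hb's : b' * s = 0 := by simpa [hss, hb'.star_eq] using congrArg star hsb'
  have hse : s * e = s := by
    have := hz (1 - e) (by rw [mul_sub, mul_one, hbe, sub_self, mul_zero])
    rw [mul_sub, mul_one, sub_eq_zero] at this
    exact this.symm
  have hes : e * s = s := by simpa [hss, he.star_eq] using congrArg star hse
  have hI : ∀ x : A, Complex.I • Complex.I • x = -x := fun x => by
    rw [smul_smul, Complex.I_mul_I, neg_one_smul]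
  have hk : star (-(b + b) + Complex.I • s) = -(b + b) - Complex.I • s := by
    rw [star_add, star_smul, hss, star_neg, star_add, hb.star_eq]
    simp [sub_eq_add_neg]
  have hmul : (-(b + b) + Complex.I • s) * star (-(b + b) + Complex.I • s) =
      -((-(b + b) + Complex.I • s) + star (-(b + b) + Complex.I • s)) := by
    rw [hk]
    simp only [add_mul, mul_sub, mul_add, neg_mul, mul_neg, smul_mul_assoc, mul_smul_comm, hcomm,
      hI, hsq, smul_sub, smul_add, smul_neg]
    module
  have hmul' : star (-(b + b) + Complex.I • s) * (-(b + b) + Complex.I • s) =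
      -((-(b + b) + Complex.I • s) + star (-(b + b) + Complex.I • s)) := by
    rw [hk]
    simp only [add_mul, sub_mul, mul_add, neg_mul, mul_neg, smul_mul_assoc, mul_smul_comm, hcomm,
      hI, hsq, smul_sub, smul_add, smul_neg]
    module
  refine ⟨-(b + b) + Complex.I • s, hmul, hmul', ?_, ?_, ?_, ?_, ?_⟩
  · rw [mul_add, mul_neg, mul_add, heb, mul_smul_comm, hes]
  · rw [add_mul, neg_mul, add_mul, hbe, smul_mul_assoc, hse]
  · rw [add_mul, neg_mul, add_mul, hbb', smul_mul_assoc, hsb', smul_zero, add_zero]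
  · rw [mul_add, mul_neg, mul_add, hb'b, mul_smul_comm, hb's, smul_zero, add_zero]
  · refine le_of_sq_le_sq ?_ (by norm_num)
    rw [sq, ← CStarRing.norm_self_mul_star, hmul, hk]
    have : -(-(b + b) + Complex.I • s + (-(b + b) - Complex.I • s)) = (4 : ℂ) • b := by module
    rw [this, norm_smul]
    have := hb.norm_le
    norm_num
    linarith

namespace IsRotation

variable {e₁ : A} {α : ℂ} {θ κ : ℝ}

theorem star_left_unit (hk : IsRotation e b k) (he : star e = e) : e * star k = star k := by
  simpa [he] using congrArg star hk.right_unit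

theorem star_right_unit (hk : IsRotation e b k) (he : star e = e) : star k * e = star k := by
  simpa [he] using congrArg star hk.left_unit

theorem star_mul_eq (hk : IsRotation e b k) (hb : star b = b) : star k * b = -(b + b) := by
  simpa [hb] using congrArg star hk.eq_mul

theorem mul_star_eq (hk : IsRotation e b k) (hb : star b = b) : b * star k = -(b + b) := by
  simpa [hb] using congrArg star hk.mul_eq

/-- Averaging `z` with its rotation clears the row and the column of the region `e` up to an error,
keeping a multiple of `W` on `b`. The error is controlled by `R`. -/
theorem exists_average (hk : IsRotation e b k) (hW : ‖W‖ ≤ 1) (he : IsRegion (star W * W) e)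
    (hb : IsRegion (star W * W) b) (heb : e * b = b) (hz : ‖z‖ ≤ 1)
    (hθ : ‖e * (star W * z) * e - α • (e * e)‖ ≤ θ) :
    ∃ y u v r : A, y = z + W * u + v * (star W * W) ∧ ‖y‖ ≤ 1 ∧ ‖r‖ ≤ 4 * θ ∧ ‖r * b‖ ≤ 2 * θ ∧
      ‖b * r‖ ≤ 2 * θ ∧
      z - y = -((2⁻¹ : ℂ) • (W * k * (star W * z) * (1 - e) +
        (1 - W * e * star W) * z * star k)) - W * r ∧
      (z - y) * b = (1 - W * e * star W) * z * b - W * (r * b) ∧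
      b * (star W * (z - y)) = b * (star W * z) * (1 - e) - b * r ∧
      ‖y * b - α • (W * b)‖ ≤ θ ∧ ‖b * (star W * y) - α • b‖ ≤ θ := by
  have hbe := hb.mul_right_unit he heb
  set R : A := e * (star W * z) * e - α • (e * e) with hR
  have hkk := hk.norm_le
  have hks : ‖star k‖ ≤ 2 := by rwa [norm_star]
  have hke := hk.right_unit
  have hek := hk.left_unit
  have hes := hk.star_left_unit he.star_eq
  have hse := hk.star_right_unit he.star_eq
  have hkb := hk.mul_eq
  have hbk := hk.eq_mul
  have hsb := hk.star_mul_eq hb.star_eq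
  have hbs := hk.mul_star_eq hb.star_eq
  have hDk : star W * (W * k) = k := by rw [← hek, he.unit_left_assoc]
  have hDk' : ∀ x, star W * (W * (k * x)) = k * x := fun x => by
    rw [← hek, mul_assoc, he.unit_left_assoc]
  have hsD : star k * (star W * W) = star k := by
    rw [← hse, mul_assoc, he.unit_right]
  have hS : ‖1 + W * k * star W‖ ≤ 1 := by
    refine (norm_le_one_iff_star_mul_self_le _).2 (le_of_eq ?_)
    simp only [star_add, star_mul, star_one, star_star, mul_add, add_mul, mul_one, one_mul,
      mul_assoc, hDk']
    rw [← mul_assoc (star k), hk.star_mul_self]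
    noncomm_ring
  have hS' : ‖1 + star k‖ ≤ 1 := by
    refine (norm_le_one_iff_star_mul_self_le _).2 (le_of_eq ?_)
    simp only [star_add, star_one, star_star, mul_add, add_mul, mul_one, one_mul, hk.mul_star_self]
    abel
  set r : A := (2⁻¹ : ℂ) • (k * R + R * star k + k * R * star k) with hr
  have hkR : ‖k * R‖ ≤ 2 * θ := (norm_mul_le _ _).trans (by gcongr)
  have hRk : ‖R * star k‖ ≤ 2 * θ := (norm_mul_le _ _).trans (by
    rw [mul_comm]; gcongr)
  have hkRk : ‖k * R * star k‖ ≤ 4 * θ := (norm_mul_le _ _).trans (by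
    have := mul_le_mul hkR hks (norm_nonneg _) ((norm_nonneg _).trans hkR)
    linarith)
  have h2 : ‖(2⁻¹ : ℂ)‖ = 1 / 2 := by norm_num
  have hrb : r * b = -((2⁻¹ : ℂ) • (k * R * b)) - R * b := by
    rw [hr]
    simp only [smul_mul_assoc, add_mul, mul_assoc, hsb, mul_neg, mul_add]
    module
  have hbr : b * r = -((2⁻¹ : ℂ) • (b * (R * star k))) - b * R := by
    rw [hr]
    simp only [mul_smul_comm, mul_add, ← mul_assoc, hbk, neg_mul, add_mul]
    module
  have hv : z - (2⁻¹ : ℂ) • (z + (1 + W * k * star W) * z * (1 + star k)) =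
      -((2⁻¹ : ℂ) • (W * k * (star W * z) * (1 - e) +
        (1 - W * e * star W) * z * star k)) - W * r := by
    rw [hr, hR]
    simp only [mul_add, add_mul, mul_sub, sub_mul, mul_one, one_mul, mul_assoc, smul_mul_assoc,
      mul_smul_comm, hke, mul_mul_of_mul_eq hke, hes, hk.mul_star_self, mul_neg]
    module
  have hvb : (z - (2⁻¹ : ℂ) • (z + (1 + W * k * star W) * z * (1 + star k))) * b =
      (1 - W * e * star W) * z * b - W * (r * b) := by
    rw [hv]
    simp only [sub_mul, add_mul, neg_mul, mul_sub, mul_one, one_mul, mul_assoc, smul_mul_assoc,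
      heb, sub_self, hsb, mul_neg, mul_add]
    module
  have hbv : b * (star W * (z - (2⁻¹ : ℂ) • (z + (1 + W * k * star W) * z * (1 + star k)))) =
      b * (star W * z) * (1 - e) - b * r := by
    rw [hv]
    simp only [mul_sub, mul_add, mul_neg, mul_smul_comm, hb.unit_right_assoc, mul_assoc, sub_mul,
      add_mul, one_mul, mul_mul_of_mul_eq hbk, mul_mul_of_mul_eq hbe, neg_mul, mul_one]
    module
  have hRb : ‖R * b‖ ≤ θ := norm_mul_le_of_right hθ hb.norm_le
  have hbR : ‖b * R‖ ≤ θ := norm_mul_le_of_left hb.norm_le hθ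
  have hkRb : ‖(2⁻¹ : ℂ) • (k * R * b)‖ ≤ θ := by
    rw [norm_smul, h2]
    linarith [norm_mul_le_of_right hkR hb.norm_le]
  have hbRk : ‖(2⁻¹ : ℂ) • (b * (R * star k))‖ ≤ θ := by
    rw [norm_smul, h2]
    linarith [norm_mul_le_of_left hb.norm_le hRk]
  refine ⟨(2⁻¹ : ℂ) • (z + (1 + W * k * star W) * z * (1 + star k)),
    (2⁻¹ : ℂ) • (k * (star W * z) * (1 + star k)), (2⁻¹ : ℂ) • (z * star k), r, ?_, ?_, ?_, ?_, ?_,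
    hv, hvb, hbv, ?_, ?_⟩
  · simp only [mul_add, add_mul, mul_one, one_mul, mul_assoc, smul_mul_assoc, mul_smul_comm, hsD]
    module
  · rw [norm_smul, h2]
    have := norm_mul_le_of_right (norm_mul_le_of_left hS hz) hS'
    linarith [norm_add_le z ((1 + W * k * star W) * z * (1 + star k))]
  · rw [hr, norm_smul, h2]
    linarith [norm_add_le (k * R + R * star k) (k * R * star k), norm_add_le (k * R) (R * star k)]
  · rw [hrb]
    refine (norm_sub_le _ _).trans ?_
    rw [norm_neg]; linarith
  · rw [hbr]
    refine (norm_sub_le _ _).trans ?_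
    rw [norm_neg]; linarith
  · have : (2⁻¹ : ℂ) • (z + (1 + W * k * star W) * z * (1 + star k)) * b - α • (W * b) =
        -(W * ((2⁻¹ : ℂ) • (k * R * b))) := by
      have e1 := congrArg (z * b - ·) hvb
      simp only [sub_mul, sub_sub_cancel] at e1
      rw [e1, hrb]
      simp only [hR, mul_sub, sub_mul, one_mul, mul_assoc, mul_neg, smul_mul_assoc,
        mul_smul_comm, heb]
      module
    rw [this, norm_neg]
    exact norm_mul_le_of_left hW hkRb
  · have : b * (star W * (2⁻¹ : ℂ) • (z + (1 + W * k * star W) * z * (1 + star k))) - α • b =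
        -((2⁻¹ : ℂ) • (b * (R * star k))) := by
      have e1 := congrArg (b * (star W * z) - ·) hbv
      simp only [mul_sub b, mul_sub (star W), sub_sub_cancel] at e1
      rw [e1, hbr]
      simp only [hR, mul_sub, sub_mul, mul_one, mul_assoc, mul_smul_comm, smul_mul_assoc,
        mul_mul_of_mul_eq hbe, hbe]
      module
    rw [this, norm_neg]
    exact hbRk

end IsRotation

end Rotation

section OffStep

variable {A : Type*} [CStarAlgebra A] [PartialOrder A] [StarOrderedRing A] {W e b k : A}

theorem IsRotation.norm_conj_le (hk : IsRotation e b k) (he : IsRegion (star W * W) e) {x : A}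
    {s θ : ℝ} (hs : 0 ≤ s) (hx : ‖e * x * e - (s : ℂ) • (e * e)‖ ≤ θ) :
    ‖k * x * star k‖ ≤ 4 * (s + θ) := by
  have e1 : k * x * star k = k * (e * x * e) * star k := by
    simp only [mul_assoc, hk.star_left_unit he.star_eq, mul_mul_of_mul_eq hk.right_unit]
  have h1 : ‖e * x * e‖ ≤ s + θ := by
    have := norm_sub_norm_le (e * x * e) ((s : ℂ) • (e * e))
    linarith [norm_smul_mul_self_le he hs]
  have hk2 := hk.norm_le
  rw [e1]
  calc ‖k * (e * x * e) * star k‖ ≤ ‖k‖ * ‖e * x * e‖ * ‖star k‖ := norm_mul₃_le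
    _ ≤ 2 * (s + θ) * 2 := by
      rw [norm_star]
      have := (norm_nonneg _).trans h1
      gcongr
    _ = 4 * (s + θ) := by ring

theorem norm_smul_sub_star_mul_self_le {a ε c : A} {s θ : ℝ} (hc : ‖c‖ ≤ 1) (ha : ‖a‖ ≤ 1)
    (hε : ‖ε‖ ≤ 2 * θ) (hθ : θ ≤ 1) (h : ‖star a * a - (s : ℂ) • c‖ ≤ θ) :
    ‖(s + 33 * θ) • c - star (a - ε) * (a - ε)‖ ≤ 42 * θ := by
  have hθ0 : 0 ≤ θ := (norm_nonneg _).trans h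
  have e1 : (s + 33 * θ) • c - star (a - ε) * (a - ε) =
      (33 * θ) • c - (star a * a - (s : ℂ) • c) + star a * ε + star ε * a - star ε * ε := by
    rw [Complex.coe_smul, star_sub]
    simp only [mul_sub, sub_mul]
    module
  have t1 : ‖(33 * θ) • c‖ ≤ 33 * θ := by
    rw [norm_smul, Real.norm_of_nonneg (by positivity)]
    exact mul_le_of_le_one_right (by positivity) hc
  have t2 : ‖star a * ε‖ ≤ 2 * θ := norm_mul_le_of_left (by rwa [norm_star]) hε
  have t3 : ‖star ε * a‖ ≤ 2 * θ := norm_mul_le_of_right (by rwa [norm_star]) ha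
  have t4 : ‖star ε * ε‖ ≤ 4 * θ := by
    rw [CStarRing.norm_star_mul_self]
    nlinarith [norm_nonneg ε]
  rw [e1]
  refine (norm_sub_le _ _).trans ?_
  have a1 := norm_add_le ((33 * θ) • c - (star a * a - (s : ℂ) • c) + star a * ε) (star ε * a)
  have a2 := norm_add_le ((33 * θ) • c - (star a * a - (s : ℂ) • c)) (star a * ε)
  have a3 := norm_sub_le ((33 * θ) • c) (star a * a - (s : ℂ) • c)
  linarith

variable {Y : Type*} [NormedAddCommGroup Y] [NormedSpace ℝ Y] {T : A → Y} {E : Set A}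

theorem IsFaceContext.off_step (ctx : IsFaceContext T E W) {z : A} (hz : z ∈ E)
    (he : IsRegion (star W * W) e) {α : ℂ} {κ μ τ : ℝ} (hτ0 : 0 < τ) (hτ1 : τ ≤ 1)
    (h0 : 0 ≤ μ) (h1 : μ ≤ 1) (hα : ‖e * (star W * z) * e - α • (e * e)‖ ≤ τ ^ 2)
    (hrow : ‖e * (star W * z)‖ ≤ κ) (hcol : ‖z * e‖ ≤ κ) :
    ∃ b y w : A, IsRegion (star W * W) b ∧ e * b = b ∧ y ∈ E ∧ w ∈ E ∧
      T w = (1 - μ) • T y + μ • T z ∧ ‖y * b - α • (W * b)‖ ≤ τ ^ 2 ∧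
      ‖b * (star W * y) - α • b‖ ≤ τ ^ 2 ∧ ‖w - y‖ ≤ μ * (2 * κ + 4 * τ ^ 2) ∧
      ‖b * (star W * w) * b - α • (b * b)‖ ≤ 3 * τ ^ 2 + 7 * τ := by
  have hW := ctx.norm_le
  have hWs : ‖star W‖ ≤ 1 := by rwa [norm_star]
  have nz := ctx.norm_eq_one z hz
  have hθ : 0 < τ ^ 2 := by positivity
  have hθ1 : τ ^ 2 ≤ 1 := pow_le_one₀ hτ0.le hτ1
  set θ := τ ^ 2 with hθdef
  set P : A := (1 - W * e * star W) * z with hP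
  set Q : A := star W * z * (1 - e) with hQ
  have hP1 : ‖P‖ ≤ 1 :=
    norm_mul_le_of_left (norm_one_sub_le he.conj_nonneg (he.norm_conj_le hW)) nz.le
  have hQ1 : ‖Q‖ ≤ 1 := norm_mul_le_of_right (norm_mul_le_of_left hWs nz.le)
    (norm_one_sub_le he.nonneg he.norm_le)
  obtain ⟨e₁, s, hs, he₁, hee₁, hexP⟩ := he.excision_nonneg (star_mul_self_nonneg P) hθ
  obtain ⟨e₂, s', hs', he₂, he₁₂, hexQ⟩ := he₁.excision_nonneg (mul_star_self_nonneg Q) hθ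
  replace hexP := (he₂.norm_compress_le he₁ he₁₂ _ _).trans hexP
  have hee₂ := IsRegion.sub_trans hee₁ he₁₂
  obtain ⟨b₁, hb₁, h21⟩ := he₂.exists_sub
  obtain ⟨b, hb, hb₁b⟩ := hb₁.exists_sub
  obtain ⟨k, hk⟩ := he₂.exists_isRotation hb₁ hb h21 hb₁b
  have h2b := IsRegion.sub_trans h21 hb₁b
  have heb := IsRegion.sub_trans hee₂ h2b
  have hke : k * e = k := by
    rw [← hk.right_unit, mul_assoc, he₂.mul_right_unit he hee₂]
  have hek : e * k = k := IsRegion.sub_trans hee₂ hk.left_unit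
  have hk' : IsRotation e b k :=
    ⟨hk.mul_star_self, hk.star_mul_self, hek, hke, hk.mul_eq, hk.eq_mul, hk.norm_le⟩
  have hes := hk'.star_left_unit he.star_eq
  have hse := hk'.star_right_unit he.star_eq
  have hbe := hb.mul_right_unit he heb
  obtain ⟨y, u, v, r, hy, hy1, hr, hrb, hbr, hv, hvb, hbv, hyb, hby⟩ :=
    hk'.exists_average hW he hb heb nz.le hα
  have hyE : y ∈ E := by rw [hy]; exact ctx.perturb_mem z hz u v (hy ▸ hy1)
  have hks : ‖star k‖ ≤ 2 := by rw [norm_star]; exact hk.norm_le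
  have hn₁ : ‖W * k * (star W * z) * (1 - e)‖ ≤ ‖k * Q‖ := by
    have : W * k * (star W * z) * (1 - e) = W * (k * Q) := by rw [hQ]; simp only [mul_assoc]
    rw [this]
    exact norm_mul_le_of_left hW le_rfl
  have hkQ : ‖k * Q‖ ≤ 2 * κ := by
    have : k * Q = k * (e * (star W * z) * (1 - e)) := by
      rw [hQ]; simp only [mul_assoc, mul_mul_of_mul_eq hke]
    rw [this]
    have h3 : ‖e * (star W * z) * (1 - e)‖ ≤ κ :=
      norm_mul_le_of_right hrow (norm_one_sub_le he.nonneg he.norm_le)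
    exact (norm_mul_le _ _).trans (mul_le_mul hk.norm_le h3 (norm_nonneg _) zero_le_two)
  have hPk : ‖P * star k‖ ≤ 2 * κ := by
    have : P * star k = (1 - W * e * star W) * (z * e) * star k := by
      rw [hP]; simp only [mul_assoc, hes]
    rw [this]
    have h3 : ‖(1 - W * e * star W) * (z * e)‖ ≤ κ :=
      norm_mul_le_of_left (norm_one_sub_le he.conj_nonneg (he.norm_conj_le hW)) hcol
    rw [mul_comm 2]
    exact (norm_mul_le _ _).trans (mul_le_mul h3 hks (norm_nonneg _) ((norm_nonneg _).trans h3))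
  have hkQ2 : ‖k * Q‖ ≤ 2 := (norm_mul_le _ _).trans
    (by simpa using mul_le_mul hk.norm_le hQ1 (norm_nonneg _) zero_le_two)
  have hPk2 : ‖P * star k‖ ≤ 2 := (norm_mul_le _ _).trans
    (by simpa using mul_le_mul hP1 hks (norm_nonneg _) zero_le_one)
  have h2 : ‖(2⁻¹ : ℂ)‖ = 1 / 2 := by norm_num
  set n : A := W * k * (star W * z) * (1 - e) + P * star k with hn
  have hvn : ‖z - y‖ ≤ ‖n‖ / 2 + 4 * θ := by
    rw [hv]
    refine (norm_sub_le _ _).trans ?_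
    rw [norm_neg, norm_smul, h2]
    linarith [norm_mul_le_of_left hW hr]
  have hn4 : ‖n‖ ≤ ‖k * Q‖ + ‖P * star k‖ := (norm_add_le _ _).trans (by linarith)
  have hv1 : ‖z - y‖ ≤ 2 * κ + 4 * θ := by linarith
  have hm0 : 0 ≤ max s s' := hs.trans (le_max_left _ _)
  have hn2 : ‖n‖ ^ 2 ≤ 4 * (max s s' + θ) := by
    refine norm_sq_add_le_of_orthogonal ?_ ?_ ?_ ?_
    · have : star k * (star W * P) = 0 := by
        rw [hP]
        simp only [sub_mul, one_mul, mul_sub, mul_assoc, he.unit_left_assoc,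
          mul_mul_of_mul_eq hse, sub_self]
      simp only [star_mul, mul_assoc]
      rw [← mul_assoc (star W) P, ← mul_assoc (star k), this]
      simp
    · have : (1 - e) * k = 0 := by rw [sub_mul, one_mul, hek, sub_self]
      simp only [star_mul, star_star, mul_assoc]
      rw [← mul_assoc (1 - e), this]
      simp
    · have h3 := hk.norm_conj_le he₂ hs' hexQ
      have h4 : ‖k * Q‖ ^ 2 = ‖k * (Q * star Q) * star k‖ := by
        rw [sq, ← CStarRing.norm_self_mul_star, star_mul]; simp only [mul_assoc]
      have h5 : ‖W * k * (star W * z) * (1 - e)‖ ^ 2 ≤ ‖k * Q‖ ^ 2 := by gcongr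
      linarith [le_max_right s s']
    · have h3 := hk.norm_conj_le he₂ hs hexP
      have h4 : ‖P * star k‖ ^ 2 = ‖k * (star P * P) * star k‖ := by
        rw [sq, ← CStarRing.norm_star_mul_self, star_mul, star_star]; simp only [mul_assoc]
      linarith [le_max_left s s']
  have hv2 : ‖z - y‖ ≤ √(max s s' + 33 * θ) := by
    refine Real.le_sqrt_of_sq_le ?_
    have h3 : ‖z - y‖ ^ 2 ≤ (‖n‖ / 2 + 4 * θ) ^ 2 := by gcongr
    nlinarith [norm_nonneg n]
  obtain ⟨w, hw, hTw⟩ := ctx.exists_combo y hyE z hz μ h0 h1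
  obtain ⟨d1, d2, d3⟩ := ctx.iso.defect_le (ctx.norm_eq_one y hyE) nz (ctx.norm_eq_one w hw) h0 h1
    hTw hv2
  rw [Real.sq_sqrt (by positivity)] at d2 d3
  have hwy : ‖w - y‖ ≤ μ * (2 * κ + 4 * θ) := by
    rw [d1]; exact mul_le_mul_of_nonneg_left hv1 h0
  set Δ : A := w - y - μ • (z - y) with hΔ
  have hbb1 : ‖b * b‖ ≤ 1 := hb.norm_mul_self.le
  have h42 : 42 * θ ≤ (7 * τ) ^ 2 := by rw [hθdef]; nlinarith
  have hcomp : ‖b * (star W * Δ) * b‖ ≤ 7 * τ := by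
    rcases le_total s' s with hss | hss
    · rw [max_eq_left hss] at d2
      have ha : ‖star (P * b) * (P * b) - (s : ℂ) • (b * b)‖ ≤ θ := by
        have := (hb.norm_compress_le he₂ h2b (star P * P) s).trans hexP
        rw [star_mul, hb.star_eq]
        simpa only [mul_assoc] using this
      have h3 := norm_smul_sub_star_mul_self_le hbb1 (norm_mul_le_of_right hP1 hb.norm_le)
        (norm_mul_le_of_left hW hrb) hθ1 ha
      have h4 : b * ((s + 33 * θ) • (1 : A) - star (z - y) * (z - y)) * b =
          (s + 33 * θ) • (b * b) - star (P * b - W * (r * b)) * (P * b - W * (r * b)) := by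
        rw [hP, ← hvb, star_mul, hb.star_eq]
        simp only [mul_sub b, sub_mul _ _ b, mul_smul_comm, smul_mul_assoc, mul_one, mul_assoc]
      have h5 := norm_sq_mul_right_le hb.star_eq d2
      rw [h4] at h5
      have h6 : ‖Δ * b‖ ≤ 7 * τ := le_of_sq_le_sq (h5.trans (h3.trans h42)) (by positivity)
      rw [mul_assoc, mul_assoc]
      exact norm_mul_le_of_left hb.norm_le (norm_mul_le_of_left hWs h6)
    · rw [max_eq_right hss] at d3
      have ha : ‖star (star (b * Q)) * star (b * Q) - (s' : ℂ) • (b * b)‖ ≤ θ := by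
        have := (hb.norm_compress_le he₂ h2b (Q * star Q) s').trans hexQ
        rw [star_star, star_mul, hb.star_eq]
        simpa only [mul_assoc] using this
      have h3 := norm_smul_sub_star_mul_self_le (ε := star (b * r)) hbb1
        (by rw [norm_star]; exact norm_mul_le_of_left hb.norm_le hQ1)
        (by rwa [norm_star]) hθ1 ha
      have hbv' : b * (star W * (z - y)) = b * Q - b * r := by
        rw [hbv, hQ]; simp only [mul_assoc]
      have h4 : b * star W * ((s' + 33 * θ) • (1 : A) - (z - y) * star (z - y)) *
          star (b * star W) = (s' + 33 * θ) • (b * b) -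
            star (star (b * Q) - star (b * r)) * (star (b * Q) - star (b * r)) := by
        rw [← star_sub, star_star, ← hbv', star_mul b, star_mul b, star_mul (star W), star_star,
          hb.star_eq]
        simp only [mul_sub (b * star W), sub_mul _ _ (W * b), mul_smul_comm, smul_mul_assoc,
          mul_one, mul_assoc, hb.unit_left]
      have h5 := norm_sq_mul_left_le (V := b * star W) d3
      rw [h4] at h5
      have h6 : ‖b * star W * Δ‖ ≤ 7 * τ :=
        le_of_sq_le_sq (h5.trans (h3.trans h42)) (by positivity)
      rw [← mul_assoc b]
      exact norm_mul_le_of_right h6 hb.norm_le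
  refine ⟨b, y, w, hb, heb, hyE, hw, hTw, hyb, hby, hwy, ?_⟩
  have hbvb : ‖b * (star W * (z - y)) * b‖ ≤ 2 * θ := by
    have : b * (star W * (z - y)) * b = -(b * r * b) := by
      rw [hbv, sub_mul]
      have : (1 - e) * b = 0 := by rw [sub_mul, one_mul, heb, sub_self]
      rw [mul_assoc _ (1 - e), this, mul_zero, zero_sub]
    rw [this, norm_neg]
    exact norm_mul_le_of_right hbr hb.norm_le
  have hbyb : ‖b * (star W * y) * b - α • (b * b)‖ ≤ θ := by
    rw [← smul_mul_assoc, ← sub_mul]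
    exact norm_mul_le_of_right hby hb.norm_le
  have hdec : b * (star W * w) * b - α • (b * b) = (b * (star W * y) * b - α • (b * b)) +
      μ • (b * (star W * (z - y)) * b) + b * (star W * Δ) * b := by
    have : Δ = w - y - μ • (z - y) := hΔ
    rw [this]
    simp only [mul_sub, sub_mul, mul_smul_comm, smul_mul_assoc]
    module
  rw [hdec]
  refine (norm_add₃_le).trans ?_
  have h3 : ‖μ • (b * (star W * (z - y)) * b)‖ ≤ 2 * θ := by
    rw [norm_smul, Real.norm_of_nonneg h0]
    exact (mul_le_of_le_one_left (norm_nonneg _) h1).trans hbvb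
  linarith

end OffStep

section ReadOff

variable {A : Type*} [CStarAlgebra A] [PartialOrder A] [StarOrderedRing A]
  {Y : Type*} [NormedAddCommGroup Y] [NormedSpace ℝ Y] {T : A → Y} {E : Set A} {W e : A}

/-- For points with small row and column along a region, support functionals on smaller regions
read off the compression up to a cubic error. -/
theorem IsFaceContext.exists_read_off_of_small (ctx : IsFaceContext T E W) {z : A} (hz : z ∈ E)
    (he : IsRegion (star W * W) e) {μ : ℝ} (hμ : 0 < μ) (hμ5 : μ ≤ 1 / 5) {α : ℂ}
    (hα : ‖α‖ ≤ 2 * μ ^ 2)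
    (hcomp : ‖e * (star W * z) * e - α • (e * e)‖ ≤ (μ ^ 4 / 10) ^ 2)
    (hrow : ‖e * (star W * z)‖ ≤ 3 * μ) (hcol : ‖z * e‖ ≤ 3 * μ) :
    ∃ h : A, IsRegion (star W * W) h ∧ e * h = h ∧
      ∀ f, IsSupport T W h f → |f (T z) - α.re| ≤ 494 * μ ^ 3 := by
  have hW := ctx.norm_le
  have hWs : ‖star W‖ ≤ 1 := by rwa [norm_star]
  have hμ1 : μ ≤ 1 := by linarith
  obtain ⟨τ, hτ⟩ : ∃ τ, τ = μ ^ 4 / 10 := ⟨_, rfl⟩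
  rw [← hτ] at hcomp
  have hτ0 : 0 < τ := by rw [hτ]; positivity
  have hμ2 : μ ^ 2 ≤ μ / 5 := by nlinarith
  have hμ4 : μ ^ 4 ≤ μ ^ 2 := pow_le_pow_of_le_one hμ.le hμ1 (by norm_num)
  have hτμ : τ ≤ μ ^ 2 / 10 := by linarith
  have hτ1 : τ ≤ 1 / 10 := by linarith
  have hττ : τ ^ 2 ≤ τ / 10 := by nlinarith
  obtain ⟨b, y, w, hb, heb, hy, hw, hTw, hyb, hby, hwy, hcompw⟩ :=
    ctx.off_step hz he hτ0 (by linarith : τ ≤ 1) hμ.le hμ1 hcomp hrow hcol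
  obtain ⟨g, hg, hbg⟩ := hb.exists_sub
  obtain ⟨h, hh, hgh⟩ := hg.exists_sub
  have hgb := hg.mul_right_unit hb hbg
  refine ⟨h, hh, IsRegion.sub_trans heb (IsRegion.sub_trans hbg hgh), fun f hf => ?_⟩
  have hcoly : ‖y * g‖ ≤ 2 * μ ^ 2 + τ ^ 2 := by
    have h1 := norm_sub_norm_le (y * b) (α • (W * b))
    have h2 : ‖α • (W * b)‖ ≤ 2 * μ ^ 2 := by
      rw [norm_smul]
      exact (mul_le_of_le_one_right (norm_nonneg _) (norm_mul_le_of_left hW hb.norm_le)).trans hα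
    rw [← hbg, ← mul_assoc]
    exact norm_mul_le_of_right (by linarith) hg.norm_le
  have hrowy : ‖g * (star W * y)‖ ≤ 2 * μ ^ 2 + τ ^ 2 := by
    have h1 := norm_sub_norm_le (b * (star W * y)) (α • b)
    have h2 : ‖α • b‖ ≤ 2 * μ ^ 2 := by
      rw [norm_smul]
      exact (mul_le_of_le_one_right (norm_nonneg _) hb.norm_le).trans hα
    rw [← hgb, mul_assoc]
    exact norm_mul_le_of_left hg.norm_le (by linarith)
  have hwy2 : ‖w - y‖ ≤ 6 * μ ^ 2 + 4 * τ ^ 2 := by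
    refine hwy.trans ?_
    nlinarith
  have hcolw : ‖w * g‖ ≤ 9 * μ ^ 2 := by
    have h1 := norm_mul_le_of_right hwy2 hg.norm_le
    have h2 := norm_add_le ((w - y) * g) (y * g)
    rw [← add_mul, sub_add_cancel] at h2
    linarith
  have hroww : ‖g * (star W * w)‖ ≤ 9 * μ ^ 2 := by
    have h1 := norm_mul_le_of_left hg.norm_le (norm_mul_le_of_left hWs hwy2)
    have h2 := norm_add_le (g * (star W * (w - y))) (g * (star W * y))
    rw [← mul_add, ← mul_add, sub_add_cancel] at h2
    linarith
  have hcompy : ‖b * (star W * y) * b - α • (b * b)‖ ≤ 10 * τ := by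
    rw [← smul_mul_assoc, ← sub_mul]
    exact (norm_mul_le_of_right hby hb.norm_le).trans (by linarith)
  have hfy := ctx.iso.abs_support_sub_le hW hb hg hh hbg hgh (ctx.norm_eq_one _ hy) hcompy
    (ρ := 9 * μ ^ 2) (hrowy.trans (by linarith)) (hcoly.trans (by linarith))
    (hα.trans (by nlinarith)) (by nlinarith) hf
  have hfw := ctx.iso.abs_support_sub_le hW hb hg hh hbg hgh (ctx.norm_eq_one _ hw)
    (hcompw.trans (by linarith : 3 * τ ^ 2 + 7 * τ ≤ 10 * τ))
    (ρ := 9 * μ ^ 2) hroww hcolw (hα.trans (by nlinarith)) (by nlinarith) hf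
  refine (abs_map_sub_le_of_combo hμ hμ1 hTw hfy
    (by convert hfw using 3; ring)).trans (le_of_eq ?_)
  rw [hτ]; field_simp; ring

/-- On small regions, every support functional approximately reads off the real part of the
scalar by which a point of `E` acts relative to `W`. -/
theorem IsFaceContext.exists_read_off (ctx : IsFaceContext T E W) {z : A} (hz : z ∈ E)
    (he : IsRegion (star W * W) e) {η : ℝ} (hη : 0 < η) :
    ∃ (h : A) (α : ℂ), IsRegion (star W * W) h ∧ e * h = h ∧
      ‖h * (star W * z) * h - α • (h * h)‖ ≤ η ∧
      ∀ f, IsSupport T W h f → |f (T z) - α.re| ≤ η := by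
  have hW := ctx.norm_le
  have hWs : ‖star W‖ ≤ 1 := by rwa [norm_star]
  have nz := ctx.norm_eq_one z hz
  have hμ : 0 < min (1 / 5) (η / 496) := by positivity
  have hμ5 : min (1 / 5) (η / 496) ≤ 1 / 5 := min_le_left _ _
  have hμη : min (1 / 5) (η / 496) ≤ η / 496 := min_le_right _ _
  set μ := min (1 / 5) (η / 496)
  have hμ1 : μ ≤ 1 := by linarith
  obtain ⟨τ, hτ⟩ : ∃ τ, τ = μ ^ 4 / 10 := ⟨_, rfl⟩
  have hτ0 : 0 < τ := by rw [hτ]; positivity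
  have hμ2 : μ ^ 2 ≤ μ / 5 := by nlinarith
  have hμ4 : μ ^ 4 ≤ μ ^ 2 := pow_le_pow_of_le_one hμ.le hμ1 (by norm_num)
  have hτμ : τ ≤ μ ^ 2 / 10 := by linarith
  have hτ1 : τ ≤ 1 / 10 := by linarith
  have hττ : τ ^ 2 ≤ τ / 10 := by nlinarith
  have hθ : 0 < τ ^ 2 / 3 := by positivity
  obtain ⟨θ, hθdef⟩ : ∃ θ, θ = τ ^ 2 / 3 := ⟨_, rfl⟩
  rw [← hθdef] at hθ
  have hθμ : θ ≤ μ := by linarith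
  obtain ⟨e₁, α, he₁, h01, hα⟩ := he.excision (star W * z) hθ
  have hα2 : ‖α‖ ≤ 2 := by
    have h1 := norm_sub_norm_le (α • (e₁ * e₁)) (e₁ * (star W * z) * e₁)
    rw [norm_sub_rev, norm_smul, he₁.norm_mul_self] at h1
    have h2 : ‖e₁ * (star W * z) * e₁‖ ≤ 1 :=
      norm_mul_le_of_right (norm_mul_le_of_left he₁.norm_le (norm_mul_le_of_left hWs nz.le))
        he₁.norm_le
    linarith
  obtain ⟨e₂, y₁, z₁, -, he₂, h12, hy₁, hz₁, hT₁, -, -, hey₁, -, hr₁⟩ :=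
    ctx.row_step hz he₁ hμ.le hμ1 hθ
  obtain ⟨e₃, he₃, h23, hf₁⟩ :=
    ctx.exists_abs_support_le_of_row_eq_zero hy₁ he₂ hey₁ (δ := μ ^ 2) (by positivity)
  obtain ⟨e₄, y₂, z₂, p, he₄, h34, hy₂, hz₂, hT₂, hyp, hp, hye₂, hzy₂, hc₂⟩ :=
    ctx.column_step hz₁ he₃ hμ.le hμ1 hθ
  obtain ⟨e₅, he₅, h45, hf₂⟩ :=
    ctx.exists_abs_support_le_of_column_eq_zero hy₂ he₄ hye₂ (δ := μ ^ 3) (by positivity)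
  have h24 := IsRegion.sub_trans h23 h34
  have h14 := IsRegion.sub_trans h12 h24
  have hrow₁ : ‖e₂ * (star W * z₁)‖ ≤ μ + θ := by
    have := norm_le_of_norm_sub_smul_le hμ.le hr₁
      (norm_mul_le_of_left he₂.norm_le (norm_mul_le_of_left hWs nz.le))
    linarith
  have h42 := he₄.mul_right_unit he₂ h24
  have hrow₁' : ‖e₄ * (star W * z₁)‖ ≤ μ + θ := by
    rw [← h42, mul_assoc]; exact norm_mul_le_of_left he₄.norm_le hrow₁
  have hrow₂ : ‖e₄ * (star W * z₂)‖ ≤ 3 * μ := by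
    have e1 : e₄ * (star W * z₂) = e₄ * (star W * (z₂ - y₂)) + e₄ * (star W * z₁) * p := by
      rw [hyp, mul_sub, mul_sub]
      simp only [mul_assoc, sub_add_cancel]
    rw [e1]
    refine (norm_add_le _ _).trans ?_
    linarith [norm_mul_le_of_left he₄.norm_le (norm_mul_le_of_left hWs hzy₂),
      norm_mul_le_of_right hrow₁' hp]
  have hcol₂ : ‖z₂ * e₄‖ ≤ 3 * μ := by
    have := norm_le_of_norm_sub_smul_le hμ.le hc₂
      (norm_mul_le_of_left (ctx.norm_eq_one z₁ hz₁).le he₄.norm_le)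
    linarith
  have hα' : ‖((μ ^ 2 : ℝ) : ℂ) * α‖ ≤ 2 * μ ^ 2 := by
    rw [norm_mul, Complex.norm_real, Real.norm_of_nonneg (by positivity)]
    nlinarith [sq_nonneg μ]
  have hre : (((μ ^ 2 : ℝ) : ℂ) * α).re = μ ^ 2 * α.re := Complex.re_ofReal_mul _ _
  have hcomp₂ : ‖e₄ * (star W * z₂) * e₄ - (((μ ^ 2 : ℝ) : ℂ) * α) • (e₄ * e₄)‖ ≤ τ ^ 2 := by
    have e1 : e₄ * (star W * z₂) * e₄ - (((μ ^ 2 : ℝ) : ℂ) * α) • (e₄ * e₄) =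
        e₄ * (star W * (z₂ * e₄ - μ • (z₁ * e₄))) +
        μ • (e₄ * (e₂ * (star W * z₁) - μ • (e₂ * (star W * z))) * e₄) +
        (μ ^ 2) • (e₄ * (star W * z) * e₄ - α • (e₄ * e₄)) := by
      rw [mul_smul, Complex.coe_smul]
      simp only [mul_sub, sub_mul, mul_smul_comm, smul_mul_assoc, mul_assoc,
        mul_mul_of_mul_eq h42]
      module
    have t1 := norm_mul_le_of_left he₄.norm_le (norm_mul_le_of_left hWs hc₂)
    have t2 := norm_mul_le_of_right (norm_mul_le_of_left he₄.norm_le hr₁) he₄.norm_le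
    have t3 := (he₄.norm_compress_le he₁ h14 _ _).trans hα
    rw [e1]
    refine norm_add₃_le.trans ?_
    rw [norm_smul, norm_smul, Real.norm_of_nonneg hμ.le, Real.norm_of_nonneg (by positivity)]
    have t2' := mul_le_mul hμ1 t2 (norm_nonneg _) zero_le_one
    have t3' := mul_le_mul (pow_le_one₀ (n := 2) hμ.le hμ1) t3 (norm_nonneg _) zero_le_one
    linarith
  obtain ⟨h, hh, h5h, hf₃⟩ := ctx.exists_read_off_of_small hz₂ he₅ hμ hμ5 hα'
    (((he₅.norm_compress_le he₄ h45 _ _).trans hcomp₂).trans (by rw [hτ]))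
    (by rw [← he₅.mul_right_unit he₄ h45, mul_assoc]
        exact norm_mul_le_of_left he₅.norm_le hrow₂)
    (by rw [← h45, ← mul_assoc]; exact norm_mul_le_of_right hcol₂ he₅.norm_le)
  have h3h := IsRegion.sub_trans h34 (IsRegion.sub_trans h45 h5h)
  have h1h := IsRegion.sub_trans h12 (IsRegion.sub_trans h23 h3h)
  refine ⟨h, α, hh, IsRegion.sub_trans h01 h1h,
    ((hh.norm_compress_le he₁ h1h _ _).trans hα).trans (by linarith), fun f hf => ?_⟩
  have k₃ := hf₃ f hf
  rw [hre] at k₃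
  have k₂ : |f (T z₁) - μ * α.re| ≤ 495 * μ ^ 2 := by
    refine (abs_map_sub_le_of_combo (c₀ := 0) hμ hμ1 hT₂
      (by simpa using hf₂ f (hf.mono h5h))
      (by convert k₃ using 3; ring)).trans (le_of_eq ?_)
    field_simp; ring
  have k₁ : |f (T z) - α.re| ≤ 496 * μ := by
    refine (abs_map_sub_le_of_combo (c₀ := 0) hμ hμ1 hT₁
      (by simpa using hf₁ f (hf.mono h3h))
      (by convert k₂ using 3; ring)).trans (le_of_eq ?_)
    field_simp; ring
  linarith

end ReadOff

section Main

variable {A : Type*} [CStarAlgebra A] [PartialOrder A] [StarOrderedRing A]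
  {Y : Type*} [NormedAddCommGroup Y] [NormedSpace ℝ Y] {T : A → Y} {E : Set A} {W : A}

theorem map_mul_sub_eq_zero (F : A →ₗ[ℝ] ℝ) (hF : ∀ x, |F x| ≤ ‖x‖) {z₁ z₂ : A}
    (h₁ : ‖z₁‖ ≤ 1) (h₂ : ‖z₂‖ ≤ 1) (hF₁ : F z₁ = 1) (hF₂ : F z₂ = 1) (w : A) :
    F (w * (z₁ - z₂)) = 0 := by
  have key : ∀ w : A, ‖w‖ ≤ 1 → F (w * ((1 / 2 : ℝ) • (z₁ - z₂))) = 0 := by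
    intro w hw
    set t := F (w * ((1 / 2 : ℝ) • (z₁ - z₂))) with ht
    have hN : 0 < 1 + t ^ 2 := by positivity
    set N := √(1 + t ^ 2) with hNdef
    have hN0 : 0 < N := Real.sqrt_pos.2 hN
    have hNN : N ^ 2 = 1 + t ^ 2 := Real.sq_sqrt hN.le
    have hrow : (N⁻¹ • (1 : A)) * star (N⁻¹ • (1 : A)) +
        ((N⁻¹ * t) • w) * star ((N⁻¹ * t) • w) ≤ 1 := by
      have e1 : (N⁻¹ • (1 : A)) * star (N⁻¹ • (1 : A)) +
          ((N⁻¹ * t) • w) * star ((N⁻¹ * t) • w) =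
          (N⁻¹ ^ 2) • (1 : A) + ((N⁻¹ * t) ^ 2) • (w * star w) := by
        simp only [star_smul, star_trivial, star_one, smul_mul_smul_comm, mul_one, sq]
      have e2 : (1 : A) = (N⁻¹ ^ 2) • (1 : A) + ((N⁻¹ * t) ^ 2) • (1 : A) := by
        rw [← add_smul, mul_pow, ← mul_one_add, ← hNN, ← mul_pow, inv_mul_cancel₀ hN0.ne', one_pow,
          one_smul]
      rw [e1]
      conv_rhs => rw [e2]
      gcongr
      exact mul_star_self_le_one hw
    have hcol : star ((1 / 2 : ℝ) • (z₁ + z₂)) * ((1 / 2 : ℝ) • (z₁ + z₂)) +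
        star ((1 / 2 : ℝ) • (z₁ - z₂)) * ((1 / 2 : ℝ) • (z₁ - z₂)) ≤ 1 := by
      have e1 : star ((1 / 2 : ℝ) • (z₁ + z₂)) * ((1 / 2 : ℝ) • (z₁ + z₂)) +
          star ((1 / 2 : ℝ) • (z₁ - z₂)) * ((1 / 2 : ℝ) • (z₁ - z₂)) =
          (1 / 2 : ℝ) • (star z₁ * z₁) + (1 / 2 : ℝ) • (star z₂ * z₂) := by
        simp only [star_smul, star_add, star_sub, star_trivial, smul_mul_smul_comm, mul_add,
          mul_sub, add_mul, sub_mul]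
        module
      have e2 : (1 : A) = (1 / 2 : ℝ) • (1 : A) + (1 / 2 : ℝ) • (1 : A) := by module
      rw [e1]
      conv_rhs => rw [e2]
      gcongr
      · exact star_mul_self_le_one h₁
      · exact star_mul_self_le_one h₂
    have h3 := (le_abs_self _).trans ((hF _).trans (norm_row_mul_column_le hrow hcol))
    rw [map_add, smul_mul_assoc, smul_mul_assoc, one_mul, map_smul, map_smul, map_smul, ← ht,
      map_add, hF₁, hF₂, smul_eq_mul, smul_eq_mul, smul_eq_mul, mul_assoc, ← mul_add,
      inv_mul_le_iff₀ hN0] at h3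
    have h4 : N ^ 2 ≤ N := by rw [hNN]; nlinarith
    have h5 : N ≤ 1 := by nlinarith
    have h6 : t ^ 2 ≤ 0 := by nlinarith
    exact pow_eq_zero_iff two_ne_zero |>.1 (le_antisymm h6 (sq_nonneg t))
  have hp : 0 < ‖w‖ + 1 := by positivity
  have h := key ((‖w‖ + 1)⁻¹ • w) (by
    rw [norm_smul, norm_inv, Real.norm_of_nonneg hp.le, inv_mul_le_iff₀ hp]; linarith)
  rw [smul_mul_assoc, mul_smul_comm, map_smul, map_smul, smul_eq_mul, smul_eq_mul] at h
  have h1 : (‖w‖ + 1)⁻¹ ≠ 0 := inv_ne_zero hp.ne'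
  simpa [h1] using h

theorem map_sub_mul_eq_zero (F : A →ₗ[ℝ] ℝ) (hF : ∀ x, |F x| ≤ ‖x‖) {z₁ z₂ : A}
    (h₁ : ‖z₁‖ ≤ 1) (h₂ : ‖z₂‖ ≤ 1) (hF₁ : F z₁ = 1) (hF₂ : F z₂ = 1) (w : A) :
    F ((z₁ - z₂) * w) = 0 := by
  let G : A →ₗ[ℝ] ℝ :=
    { toFun := fun x => F (star x)
      map_add' := fun x y => by rw [star_add, map_add]
      map_smul' := fun r x => by rw [star_smul, star_trivial, map_smul, RingHom.id_apply] }
  have hG : ∀ x, G x = F (star x) := fun _ => rfl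
  have := map_mul_sub_eq_zero G (fun x => by simpa [hG] using hF (star x))
    (z₁ := star z₁) (z₂ := star z₂) (by simpa) (by simpa) (by simpa [hG]) (by simpa [hG]) (star w)
  simpa [hG] using this

theorem IsSphereIsometry.isFaceContext (hT : IsSphereIsometry T) (hE : IsMaximalFace E)
    {z₁ z₂ : A} (h₁ : z₁ ∈ E) (h₂ : z₂ ∈ E) (hW : ‖W‖ ≤ 1) (hr : ∃ u, W = (z₁ - z₂) * u)
    (hl : ∃ u, star W * W = u * (z₁ - z₂)) : IsFaceContext T E W := by
  refine ⟨hT, hW, fun z hz => hE.norm_eq_one hz, fun z hz u v h => ?_,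
    fun y hy z hz μ h0 h1 => hT.exists_mem_map_eq_combo hE hy hz h0 h1⟩
  obtain ⟨F, hF, hEF⟩ := hE.exists_dual
  obtain ⟨p, hp⟩ := hr
  obtain ⟨p', hp'⟩ := hl
  have hz' := hz
  rw [hEF] at h₁ h₂ hz' ⊢
  refine ⟨h, ?_⟩
  have e1 : F (W * u) = 0 := by
    rw [hp, mul_assoc]
    exact map_sub_mul_eq_zero F.toLinearMap hF h₁.1 h₂.1 h₁.2 h₂.2 _
  have e2 : F (v * (star W * W)) = 0 := by
    rw [hp', ← mul_assoc]
    exact map_mul_sub_eq_zero F.toLinearMap hF h₁.1 h₂.1 h₁.2 h₂.2 _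
  rw [map_add, map_add, e1, e2, hz'.2, add_zero, add_zero]

theorem IsRegion.le_of_norm_compress_sub_le {h q : A} (hh : IsRegion (star W * W) h) {c r : ℝ}
    {β : ℂ} (hq : c • (star W * W) ≤ star W * q)
    (hβ : ‖h * (star W * q) * h - β • (h * h)‖ ≤ r) : c - β.re ≤ r := by
  rcases le_or_gt (c - β.re) 0 with h0 | h0
  · exact h0.trans ((norm_nonneg _).trans hβ)
  set R := h * (star W * q) * h - β • (h * h) with hR
  set S := h * (star W * q) * h - c • (h * h) with hS
  have hS0 : 0 ≤ S := by
    have := star_left_conjugate_le_conjugate hq h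
    rw [hh.star_eq] at this
    rw [hS, sub_nonneg]
    convert this using 1
    rw [mul_smul_comm, smul_mul_assoc, hh.unit_right]
  have hRS : (1 / 2 : ℝ) • (R + star R) = S + (c - β.re) • (h * h) := by
    have e1 : R = S + ((c : ℂ) - β) • (h * h) := by
      rw [hR, hS, sub_smul, Complex.coe_smul]; abel
    have e2 : (c : ℂ) - β + star ((c : ℂ) - β) = ((2 * (c - β.re) : ℝ) : ℂ) := by
      have := Complex.add_conj ((c : ℂ) - β)
      simpa using this
    have e3 : R + star R = (2 : ℝ) • S + (2 * (c - β.re)) • (h * h) := by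
      rw [e1, star_add, star_smul, star_mul, hh.star_eq, (IsSelfAdjoint.of_nonneg hS0).star_eq,
        ← Complex.coe_smul (2 * (c - β.re)), ← e2, add_smul]
      module
    rw [e3]; module
  have h1 : ‖(c - β.re) • (h * h)‖ ≤ ‖(1 / 2 : ℝ) • (R + star R)‖ := by
    refine CStarAlgebra.norm_le_norm_of_nonneg_of_le ?_ ?_
    · have := star_mul_self_nonneg h
      rw [hh.star_eq] at this
      exact smul_nonneg h0.le this
    · rw [hRS]; exact le_add_of_nonneg_left hS0
  rw [norm_smul, norm_smul, hh.norm_mul_self, mul_one, Real.norm_of_nonneg h0.le,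
    Real.norm_of_nonneg (by norm_num)] at h1
  have h2 := norm_add_le R (star R)
  rw [norm_star] at h2
  linarith

theorem IsSphereIsometry.map_combo (hT : IsSphereIsometry T) (hE : IsMaximalFace E) {x y : A}
    (hx : x ∈ E) (hy : y ∈ E) {α : ℝ} (h0 : 0 ≤ α) (h1 : α ≤ 1) :
    T (α • x + (1 - α) • y) = α • T x + (1 - α) • T y := by
  obtain ⟨m, hm, hTm⟩ := hT.exists_mem_map_eq_combo hE hy hx h0 h1
  have hc : α • x + (1 - α) • y ∈ E := hE.1.2.1 hx hy h0 (by linarith) (by ring)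
  by_cases hq : m - (α • x + (1 - α) • y) = 0
  · rw [← sub_eq_zero.1 hq, hTm, add_comm]
  exfalso
  obtain ⟨W, b, hW, hb, hr, hl, hpos⟩ := exists_polar hq
  have ctx := hT.isFaceContext hE hm hc hW hr hl
  have hη : 0 < ‖m - (α • x + (1 - α) • y)‖ / 16 := by positivity
  set q := m - (α • x + (1 - α) • y) with hqdef
  set η := ‖q‖ / 16 with hηdef
  obtain ⟨b₁, a₁, hb₁, -, hc₁, hf₁⟩ := ctx.exists_read_off hx hb hη
  obtain ⟨b₂, a₂, hb₂, h12, hc₂, hf₂⟩ := ctx.exists_read_off hy hb₁ hη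
  obtain ⟨b₃, a₃, hb₃, h23, hc₃, hf₃⟩ := ctx.exists_read_off hm hb₂ hη
  have h13 := IsRegion.sub_trans h12 h23
  obtain ⟨f, hf⟩ := hT.exists_isSupport hb₃
  have k₁ := hf₁ f (hf.mono h13)
  have k₂ := hf₂ f (hf.mono h23)
  have k₃ := hf₃ f hf
  have l₁ := (hb₃.norm_compress_le hb₁ h13 _ _).trans hc₁
  have l₂ := (hb₃.norm_compress_le hb₂ h23 _ _).trans hc₂
  have hre : (a₃ - α • a₁ - (1 - α) • a₂).re ≤ 2 * η := by
    rw [hTm, map_add, map_smul, map_smul, smul_eq_mul, smul_eq_mul] at k₃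
    rw [Complex.sub_re, Complex.sub_re, Complex.smul_re, Complex.smul_re, smul_eq_mul, smul_eq_mul]
    rw [abs_le] at k₁ k₂ k₃
    nlinarith
  have hcomp : ‖b₃ * (star W * q) * b₃ - (a₃ - α • a₁ - (1 - α) • a₂) • (b₃ * b₃)‖ ≤ 2 * η := by
    have e : b₃ * (star W * q) * b₃ - (a₃ - α • a₁ - (1 - α) • a₂) • (b₃ * b₃) =
        (b₃ * (star W * m) * b₃ - a₃ • (b₃ * b₃)) -
        (α • (b₃ * (star W * x) * b₃ - a₁ • (b₃ * b₃)) +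
          (1 - α) • (b₃ * (star W * y) * b₃ - a₂ • (b₃ * b₃))) := by
      simp only [hqdef, mul_sub, mul_add, sub_mul, add_mul, mul_smul_comm, smul_mul_assoc,
        sub_smul, smul_sub, smul_assoc, one_smul]
      abel
    rw [e]
    refine (norm_sub_le _ _).trans ((add_le_add hc₃ (norm_add_le _ _)).trans ?_)
    rw [norm_smul, norm_smul, Real.norm_of_nonneg h0, Real.norm_of_nonneg (by linarith)]
    nlinarith
  have := hb₃.le_of_norm_compress_sub_le hpos hcomp
  have : 0 < ‖q‖ := norm_pos_iff.2 hq
  linarith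

end Main

/-- Let `A` be a unital complex C*-algebra (regarded as a real Banach space), `Y` a real
normed space, `T : S_A → S_Y` a surjective isometry and `E ⊆ S_A` a maximal face. Then the
restriction of `T` to `E` is affine. -/
theorem restriction_to_maximalFace_affine
    (A : Type*) [CStarAlgebra A]
    (Y : Type*) [NormedAddCommGroup Y] [NormedSpace ℝ Y]
    (T : A → Y)
    (hiso : ∀ x ∈ Metric.sphere (0 : A) 1, ∀ y ∈ Metric.sphere (0 : A) 1,
      dist (T x) (T y) = dist x y)
    (hsurj : T '' Metric.sphere (0 : A) 1 = Metric.sphere (0 : Y) 1)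
    (E : Set A) (hE : IsMaximalFace E) :
    ∀ x ∈ E, ∀ y ∈ E, ∀ α ∈ Set.Icc (0 : ℝ) 1,
      T (α • x + (1 - α) • y) = α • T x + (1 - α) • T y := by

  let _ := CStarAlgebra.spectralOrder A
  have _ := CStarAlgebra.spectralOrderedRing A
  have hT : IsSphereIsometry T := by
    refine ⟨fun x y hx hy => ?_, fun x hx => ?_, fun p hp => ?_⟩
    · rw [← dist_eq_norm, ← dist_eq_norm]
      exact hiso x (mem_sphere_zero_iff_norm.2 hx) y (mem_sphere_zero_iff_norm.2 hy)
    · exact mem_sphere_zero_iff_norm.1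
        (hsurj ▸ Set.mem_image_of_mem T (mem_sphere_zero_iff_norm.2 hx))
    · obtain ⟨x, hx, h⟩ := hsurj.ge (mem_sphere_zero_iff_norm.2 hp)
      exact ⟨x, mem_sphere_zero_iff_norm.1 hx, h⟩
  exact fun x hx y hy α hα => hT.map_combo hE hx hy hα.1 hα.2
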